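/- The family of languages generated by capacity-bounded Ginsburg–Spanier phrase structure grammars equals the family of matrix languages of finite index: GS_cb = MAT_fin. -/

import Mathlib

/-! Common definitions: symbols, context-free grammars, Ginsburg–Spanier phrase
structure grammars, capacity-bounded derivations, matrix/vector grammars,
finite index, cf Petri nets with place capacities, and language families. -/

inductive Symb (N T : Type) where
  | nt : N → Symb N T
  | tm : T → Symb N T
deriving DecidableEq

namespace CapGram

variable {N T Δ α : Type}

open Classical in
/-- Number of occurrences of the nonterminal `A` in a sentential form. -/
noncomputable def symCount (A : N) : List (Symb N T) → ℕ
  | [] => 0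
  | Symb.nt B :: r => (if B = A then 1 else 0) + symCount A r
  | Symb.tm _ :: r => symCount A r

/-- Total number of nonterminal occurrences in a sentential form. -/
def ntCount : List (Symb N T) → ℕ
  | [] => 0
  | Symb.nt _ :: r => 1 + ntCount r
  | Symb.tm _ :: r => ntCount r

/-- The sentential form `w` respects the capacity function `κ`. -/
def CapOK (κ : N → ℕ) (w : List (Symb N T)) : Prop :=
  ∀ A : N, symCount A w ≤ κ A

/-- A context-free grammar (rules are pairs of a nonterminal and a word). -/
structure CFG (N T : Type) where
  start : N
  rules : Finset (N × List (Symb N T))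

/-- Application of a single context-free rule. -/
def applyRule (r : N × List (Symb N T)) (u v : List (Symb N T)) : Prop :=
  ∃ x y : List (Symb N T), u = x ++ Symb.nt r.1 :: y ∧ v = x ++ r.2 ++ y

def CFG.Step (G : CFG N T) (u v : List (Symb N T)) : Prop :=
  ∃ r ∈ G.rules, applyRule r u v

/-- A derivation step both of whose sentential forms respect the capacity. -/
def CFG.CapStep (G : CFG N T) (κ : N → ℕ) (u v : List (Symb N T)) : Prop :=
  G.Step u v ∧ CapOK κ u ∧ CapOK κ v

/-- A derivation step both of whose sentential forms have at most `k`
nonterminal occurrences in total. -/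
def CFG.IdxStep (G : CFG N T) (k : ℕ) (u v : List (Symb N T)) : Prop :=
  G.Step u v ∧ ntCount u ≤ k ∧ ntCount v ≤ k

/-- The (unrestricted) language of a context-free grammar. -/
def CFG.Lang (G : CFG N T) : Set (List T) :=
  { w | Relation.ReflTransGen G.Step [Symb.nt G.start] (w.map Symb.tm) }

/-- The language of the capacity-bounded grammar `(G, κ)`. -/
def CFG.CapLang (G : CFG N T) (κ : N → ℕ) : Set (List T) :=
  { w | Relation.ReflTransGen (G.CapStep κ) [Symb.nt G.start] (w.map Symb.tm) }

/-- Words with a derivation of index at most `k`. -/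
def CFG.FinLang (G : CFG N T) (k : ℕ) : Set (List T) :=
  { w | Relation.ReflTransGen (G.IdxStep k) [Symb.nt G.start] (w.map Symb.tm) }

/-- A phrase structure grammar due to Ginsburg and Spanier: the left-hand side
of a rule is a nonempty word of nonterminals, encoded as head and tail. -/
structure GSG (N T : Type) where
  start : N
  rules : Finset ((N × List N) × List (Symb N T))

def GSG.Step (G : GSG N T) (u v : List (Symb N T)) : Prop :=
  ∃ r ∈ G.rules, ∃ x y : List (Symb N T),
    u = x ++ (r.1.1 :: r.1.2).map Symb.nt ++ y ∧ v = x ++ r.2 ++ y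

def GSG.CapStep (G : GSG N T) (κ : N → ℕ) (u v : List (Symb N T)) : Prop :=
  G.Step u v ∧ CapOK κ u ∧ CapOK κ v

def GSG.Lang (G : GSG N T) : Set (List T) :=
  { w | Relation.ReflTransGen G.Step [Symb.nt G.start] (w.map Symb.tm) }

def GSG.CapLang (G : GSG N T) (κ : N → ℕ) : Set (List T) :=
  { w | Relation.ReflTransGen (G.CapStep κ) [Symb.nt G.start] (w.map Symb.tm) }

/-- Derivations labeled by their sequence of context-free rules, where every
sentential form (including the first and last) satisfies the invariant `P`. -/
inductive DerivP (P : List (Symb N T) → Prop) :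
    List (N × List (Symb N T)) → List (Symb N T) → List (Symb N T) → Prop
  | nil (u : List (Symb N T)) : P u → DerivP P [] u u
  | cons {r π u v w} : P u → applyRule r u v → DerivP P π v w →
      DerivP P (r :: π) u w

/-- A matrix grammar: a finite set of matrices (sequences of cf rules). -/
structure MG (N T : Type) where
  start : N
  mats : Finset (List (N × List (Symb N T)))

/-- Matrix language: rule sequences are concatenations of matrices. -/
def MG.Lang (G : MG N T) : Set (List T) :=
  { w | ∃ ms : List (List (N × List (Symb N T))),
      (∀ m ∈ ms, m ∈ G.mats) ∧
      DerivP (fun _ => True) ms.flatten [Symb.nt G.start] (w.map Symb.tm) }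

/-- Words with a matrix derivation of index at most `k`. -/
def MG.FinLang (G : MG N T) (k : ℕ) : Set (List T) :=
  { w | ∃ ms : List (List (N × List (Symb N T))),
      (∀ m ∈ ms, m ∈ G.mats) ∧
      DerivP (fun u => ntCount u ≤ k) ms.flatten [Symb.nt G.start] (w.map Symb.tm) }

/-- `Shuffle ms π`: `π` is an interleaving (shuffle) of the lists in `ms`. -/
inductive Shuffle : List (List α) → List α → Prop
  | nil (ms : List (List α)) : (∀ l ∈ ms, l = []) → Shuffle ms []
  | cons {ms₁ : List (List α)} {l : List α} {ms₂ : List (List α)} {π : List α}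
      (a : α) : Shuffle (ms₁ ++ l :: ms₂) π →
      Shuffle (ms₁ ++ (a :: l) :: ms₂) (a :: π)

/-- A vector grammar: like a matrix grammar, but derivations use shuffles. -/
structure VG (N T : Type) where
  start : N
  mats : Finset (List (N × List (Symb N T)))

def VG.Lang (G : VG N T) : Set (List T) :=
  { w | ∃ ms π, (∀ m ∈ ms, m ∈ G.mats) ∧ Shuffle ms π ∧
      DerivP (fun _ => True) π [Symb.nt G.start] (w.map Symb.tm) }

def VG.CapLang (G : VG N T) (κ : N → ℕ) : Set (List T) :=
  { w | ∃ ms π, (∀ m ∈ ms, m ∈ G.mats) ∧ Shuffle ms π ∧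
      DerivP (CapOK κ) π [Symb.nt G.start] (w.map Symb.tm) }

def VG.FinLang (G : VG N T) (k : ℕ) : Set (List T) :=
  { w | ∃ ms π, (∀ m ∈ ms, m ∈ G.mats) ∧ Shuffle ms π ∧
      DerivP (fun u => ntCount u ≤ k) π [Symb.nt G.start] (w.map Symb.tm) }

/-! cf Petri nets: places are in bijection with the nonterminals, transitions
with the rules; firing the transition of rule `A → α` consumes one token from
the place of `A` and adds `|α|_X` tokens to the place of each nonterminal `X`. -/

open Classical in
/-- Firing of the transition corresponding to rule `r`, turning marking `μ`
into marking `μ'`. -/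
noncomputable def ruleFire (r : N × List (Symb N T)) (μ μ' : N → ℕ) : Prop :=
  1 ≤ μ r.1 ∧ ∀ A, μ' A = μ A - (if A = r.1 then 1 else 0) + symCount A r.2

/-- Occurrence sequences of the cf Petri net of `G`, all of whose markings
(including initial and final) satisfy the validity predicate `P`. -/
inductive FireSeqP (G : CFG N T) (P : (N → ℕ) → Prop) :
    List (N × List (Symb N T)) → (N → ℕ) → (N → ℕ) → Prop
  | nil (μ : N → ℕ) : P μ → FireSeqP G P [] μ μ
  | cons {r π μ μ' μ''} : r ∈ G.rules → P μ → ruleFire r μ μ' →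
      FireSeqP G P π μ' μ'' → FireSeqP G P (r :: π) μ μ''

open Classical in
/-- The initial marking: one token on the place of the start symbol. -/
noncomputable def initMark (G : CFG N T) : N → ℕ :=
  fun A => if A = G.start then 1 else 0

/-- The language of `G` controlled by its cf Petri net restricted to markings
satisfying `P` (e.g. a place capacity constraint). -/
def CFG.PNLang (G : CFG N T) (P : (N → ℕ) → Prop) : Set (List T) :=
  { w | ∃ π μ, DerivP (fun _ => True) π [Symb.nt G.start] (w.map Symb.tm) ∧
      FireSeqP G P π (initMark G) μ }

/-! Language families over a terminal alphabet `T`. -/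

/-- Context-free languages of finite index. -/
def CFfin (T : Type) : Set (Set (List T)) :=
  { L | ∃ (N : Type) (_ : Fintype N) (G : CFG N T) (k : ℕ),
      L = G.Lang ∧ G.Lang ⊆ G.FinLang k }

/-- Languages of capacity-bounded context-free grammars. -/
def CFcb (T : Type) : Set (Set (List T)) :=
  { L | ∃ (N : Type) (_ : Fintype N) (G : CFG N T) (κ : N → ℕ),
      L = G.CapLang κ }

/-- Languages of capacity-bounded Ginsburg–Spanier phrase structure grammars. -/
def GScb (T : Type) : Set (Set (List T)) :=
  { L | ∃ (N : Type) (_ : Fintype N) (G : GSG N T) (κ : N → ℕ),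
      L = G.CapLang κ }

/-- Matrix languages of finite index. -/
def MATfin (T : Type) : Set (Set (List T)) :=
  { L | ∃ (N : Type) (_ : Fintype N) (G : MG N T) (k : ℕ),
      L = G.Lang ∧ G.Lang ⊆ G.FinLang k }

/-- Capacity-bounded vector languages (erasing rules allowed). -/
def Vcb (T : Type) : Set (Set (List T)) :=
  { L | ∃ (N : Type) (_ : Fintype N) (G : VG N T) (κ : N → ℕ),
      L = G.CapLang κ }

/-- Vector languages of finite index (erasing rules allowed). -/
def Vfin (T : Type) : Set (Set (List T)) :=
  { L | ∃ (N : Type) (_ : Fintype N) (G : VG N T) (k : ℕ),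
      L = G.Lang ∧ G.Lang ⊆ G.FinLang k }

/-- Languages of grammars controlled by cf Petri nets with place capacities. -/
def PNcap (T : Type) : Set (Set (List T)) :=
  { L | ∃ (N : Type) (_ : Fintype N) (G : CFG N T) (κ : N → ℕ),
      L = G.PNLang (fun μ => ∀ A, μ A ≤ κ A) }


/-! ### Counting nonterminals and composing derivations -/

theorem symCount_append (A : N) (u v : List (Symb N T)) :
    symCount A (u ++ v) = symCount A u + symCount A v := by
  induction u with
  | nil => simp [symCount]
  | cons s u ih => cases s <;> simp [symCount, ih, Nat.add_assoc]

theorem ntCount_append (u v : List (Symb N T)) : ntCount (u ++ v) = ntCount u + ntCount v := by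
  induction u with
  | nil => simp [ntCount]
  | cons s u ih => cases s <;> simp [ntCount, ih, Nat.add_assoc]

open Classical in
theorem symCount_map_nt (A : N) (l : List N) :
    symCount A (l.map Symb.nt : List (Symb N T)) = l.count A := by
  induction l with
  | nil => simp [symCount]
  | cons B l ih => simp [symCount, ih, List.count_cons, Nat.add_comm]

theorem ntCount_map_nt (l : List N) : ntCount (l.map Symb.nt : List (Symb N T)) = l.length := by
  induction l with
  | nil => simp [ntCount]
  | cons B l ih => simp [ntCount, ih, Nat.add_comm]

theorem symCount_map_tm (A : N) (w : List T) :
    symCount A (w.map Symb.tm : List (Symb N T)) = 0 := by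
  induction w with
  | nil => simp [symCount]
  | cons t w ih => simp [symCount, ih]

theorem ntCount_map_tm (w : List T) : ntCount (w.map Symb.tm : List (Symb N T)) = 0 := by
  induction w with
  | nil => simp [ntCount]
  | cons t w ih => simp [ntCount, ih]

theorem exists_eq_map_tm_of_ntCount_eq_zero {u : List (Symb N T)} (h : ntCount u = 0) :
    ∃ w : List T, u = w.map Symb.tm := by
  induction u with
  | nil => exact ⟨[], rfl⟩
  | cons s u ih =>
    cases s with
    | nt A => simp [ntCount] at h
    | tm t =>
      obtain ⟨w, rfl⟩ := ih (by simpa [ntCount] using h)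
      exact ⟨t :: w, rfl⟩

theorem nt_notMem_map_tm (A : N) (w : List T) :
    (Symb.nt A : Symb N T) ∉ w.map Symb.tm := by simp

theorem ntCount_eq_sum [Fintype N] (u : List (Symb N T)) :
    ntCount u = ∑ A, symCount A u := by
  induction u with
  | nil => simp [symCount, ntCount]
  | cons s u ih =>
    classical
    cases s with
    | nt A =>
      have : ∑ B, (if A = B then 1 else 0) = 1 := by simp
      simp only [symCount, ntCount, ih, Finset.sum_add_distrib]
      convert congrArg (· + ∑ B, symCount B u) this.symm using 3
    | tm t => simp [symCount, ntCount, ih]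

theorem CapOK.ntCount_le [Fintype N] {κ : N → ℕ} {u : List (Symb N T)} (h : CapOK κ u) :
    ntCount u ≤ ∑ A, κ A := by
  rw [ntCount_eq_sum]
  exact Finset.sum_le_sum fun A _ => h A

theorem DerivP.append {P : List (Symb N T) → Prop} {π₁ π₂ : List (N × List (Symb N T))}
    {u v w : List (Symb N T)} (h₁ : DerivP P π₁ u v) (h₂ : DerivP P π₂ v w) :
    DerivP P (π₁ ++ π₂) u w := by
  induction h₁ with
  | nil u _ => exact h₂
  | cons hu hr _ ih => exact .cons hu hr (ih h₂)

theorem DerivP.exists_of_append {P : List (Symb N T) → Prop}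
    {π₁ π₂ : List (N × List (Symb N T))} {u w : List (Symb N T)}
    (h : DerivP P (π₁ ++ π₂) u w) : ∃ v, DerivP P π₁ u v ∧ DerivP P π₂ v w := by
  induction π₁ generalizing u with
  | nil =>
    refine ⟨u, .nil u ?_, h⟩
    cases h <;> assumption
  | cons r π₁ ih =>
    cases h with
    | cons hu hr h =>
      obtain ⟨v, h₁, h₂⟩ := ih h
      exact ⟨v, .cons hu hr h₁, h₂⟩

theorem DerivP.mono {P Q : List (Symb N T) → Prop} (hPQ : ∀ u, P u → Q u)
    {π : List (N × List (Symb N T))} {u w : List (Symb N T)} (h : DerivP P π u w) :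
    DerivP Q π u w := by
  induction h with
  | nil u hu => exact .nil u (hPQ _ hu)
  | cons hu hr _ ih => exact .cons (hPQ _ hu) hr ih

theorem MG.FinLang_subset_Lang (G : MG N T) (k : ℕ) : G.FinLang k ⊆ G.Lang := by
  rintro w ⟨ms, hms, h⟩
  exact ⟨ms, hms, h.mono fun _ _ => trivial⟩

/-! ### From capacity-bounded grammars to matrix grammars of finite index

Maximal runs of nonterminals become single block nonterminals, and a control
nonterminal stores how often each original nonterminal occurs. -/

/-- Nonterminals of the block grammar: the start symbol `none`, control symbols
carrying a vector of counts, and blocks of at most `K` nonterminals. -/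
abbrev BlockNT (κ : N → ℕ) (K : ℕ) : Type := Option (Set.Iic κ ⊕ {l : List N // l.length ≤ K})

section Blocks

variable {κ : N → ℕ} {K : ℕ}

/-- The control symbol carrying the counts `q`. -/
def ctlSym (q : Set.Iic κ) : BlockNT κ K := some (Sum.inl q)

/-- The nonterminal standing for the block `B`. -/
def blockSym (B : {l : List N // l.length ≤ K}) : BlockNT κ K := some (Sum.inr B)

/-- The block `B` as a word, which is empty if `B` is empty (or too long). -/
def blockWord (κ : N → ℕ) (K : ℕ) (B : List N) : List (Symb (BlockNT κ K) T) :=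
  if h : B ≠ [] ∧ B.length ≤ K then [Symb.nt (blockSym ⟨B, h.2⟩)] else []

/-- Replace all maximal runs of nonterminals by blocks; the first argument is
the run that has been read so far. -/
def toBlocks (κ : N → ℕ) (K : ℕ) :
    List N → List (Symb N T) → List (Symb (BlockNT κ K) T)
  | p, [] => blockWord κ K p
  | p, Symb.nt A :: r => toBlocks κ K (p ++ [A]) r
  | p, Symb.tm t :: r => blockWord κ K p ++ Symb.tm t :: toBlocks κ K [] r

/-- Replace blocks by the nonterminals they consist of. -/
def unblock : List (Symb (BlockNT κ K) T) → List (Symb N T)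
  | [] => []
  | Symb.nt (some (Sum.inr B)) :: r => B.1.map Symb.nt ++ unblock r
  | Symb.nt _ :: r => unblock r
  | Symb.tm t :: r => Symb.tm t :: unblock r

/-- Words over blocks and terminals. -/
def IsBlockWord (w : List (Symb (BlockNT κ K) T)) : Prop :=
  ∀ A, Symb.nt A ∈ w → ∃ B, A = blockSym B

theorem unblock_append (u v : List (Symb (BlockNT κ K) T)) :
    unblock (u ++ v) = unblock u ++ unblock v := by
  induction u with
  | nil => rfl
  | cons s u ih => rcases s with (_ | _ | _) | _ <;> simp [unblock, ih]

theorem unblock_blockSym (B : {l : List N // l.length ≤ K}) (w : List (Symb (BlockNT κ K) T)) :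
    unblock (Symb.nt (blockSym B) :: w) = B.1.map Symb.nt ++ unblock w := rfl

theorem unblock_map_tm (w : List T) :
    unblock (w.map Symb.tm : List (Symb (BlockNT κ K) T)) = w.map Symb.tm := by
  induction w with
  | nil => rfl
  | cons t w ih => simp [unblock, ih]

theorem unblock_blockWord {B : List N} (h : B.length ≤ K) :
    unblock (blockWord κ K B : List (Symb (BlockNT κ K) T)) = B.map Symb.nt := by
  unfold blockWord
  split_ifs with h'
  · simp [unblock_blockSym, unblock]
  · have : B = [] := by tauto
    simp [this, unblock]

theorem unblock_toBlocks {p : List N} {u : List (Symb N T)} (h : p.length + ntCount u ≤ K) :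
    unblock (toBlocks κ K p u) = p.map Symb.nt ++ u := by
  induction u generalizing p with
  | nil => simpa [toBlocks] using unblock_blockWord (by simpa [ntCount] using h)
  | cons s u ih =>
    cases s with
    | nt A =>
      rw [toBlocks, ih (by simp [ntCount] at h ⊢; omega)]
      simp
    | tm t =>
      simp only [ntCount] at h
      simp only [toBlocks, unblock_append, unblock]
      rw [unblock_blockWord (by omega), ih (by simp; omega)]
      simp

theorem ntCount_blockWord_le (B : List N) :
    ntCount (blockWord κ K B : List (Symb (BlockNT κ K) T)) ≤ B.length := by
  unfold blockWord
  split_ifs with h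
  · have := List.length_pos_iff.2 h.1
    simp [ntCount]; omega
  · simp [ntCount]

theorem ntCount_toBlocks_le (p : List N) (u : List (Symb N T)) :
    ntCount (toBlocks κ K p u) ≤ p.length + ntCount u := by
  induction u generalizing p with
  | nil => simpa [toBlocks, ntCount] using ntCount_blockWord_le p
  | cons s u ih =>
    cases s with
    | nt A =>
      have := ih (p ++ [A])
      simp [toBlocks, ntCount] at this ⊢; omega
    | tm t =>
      have h₁ := ih []
      have h₂ := ntCount_blockWord_le (T := T) (κ := κ) (K := K) p
      simp [toBlocks, ntCount, ntCount_append] at h₁ ⊢; omega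

theorem isBlockWord_blockWord (B : List N) :
    IsBlockWord (blockWord κ K B : List (Symb (BlockNT κ K) T)) := by
  intro A hA
  unfold blockWord at hA
  split_ifs at hA
  · simp only [List.mem_singleton, Symb.nt.injEq] at hA
    exact ⟨_, hA⟩
  · simp at hA

theorem isBlockWord_toBlocks (p : List N) (u : List (Symb N T)) :
    IsBlockWord (toBlocks κ K p u) := by
  induction u generalizing p with
  | nil => exact isBlockWord_blockWord p
  | cons s u ih =>
    cases s with
    | nt A => exact ih _
    | tm t =>
      intro A hA
      simp only [toBlocks, List.mem_append, List.mem_cons, reduceCtorEq, false_or] at hA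
      exact hA.elim (isBlockWord_blockWord p A) (ih _ A)

theorem toBlocks_map_nt (p b : List N) :
    toBlocks κ K p (b.map Symb.nt : List (Symb N T)) = blockWord κ K (p ++ b) := by
  induction b generalizing p with
  | nil => simp [toBlocks]
  | cons B b ih => simp [toBlocks, ih]

theorem toBlocks_map_nt_append (p b : List N) (u : List (Symb N T)) :
    toBlocks κ K p (b.map Symb.nt ++ u) = toBlocks κ K (p ++ b) u := by
  induction b generalizing p with
  | nil => simp
  | cons B b ih => simp [toBlocks, ih]

theorem exists_toBlocks_append_left (κ : N → ℕ) (K : ℕ) (p : List N) (x : List (Symb N T)) :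
    ∃ (o : List (Symb (BlockNT κ K) T)) (q : List N),
      q.length ≤ p.length + ntCount x ∧ ∀ z, toBlocks κ K p (x ++ z) = o ++ toBlocks κ K q z := by
  induction x generalizing p with
  | nil => exact ⟨[], p, by simp, fun z => rfl⟩
  | cons s x ih =>
    cases s with
    | nt A =>
      obtain ⟨o, q, hq, h⟩ := ih (p ++ [A])
      exact ⟨o, q, by simp [ntCount] at hq ⊢; omega, h⟩
    | tm t =>
      obtain ⟨o, q, hq, h⟩ := ih []
      exact ⟨blockWord κ K p ++ Symb.tm t :: o, q, by simp [ntCount] at hq ⊢; omega,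
        fun z => by simp [toBlocks, h]⟩

theorem exists_toBlocks_append_right (κ : N → ℕ) (K : ℕ) (y : List (Symb N T)) :
    ∃ (o : List (Symb (BlockNT κ K) T)) (b : List N), b.length ≤ ntCount y ∧
      ∀ p z, toBlocks κ K p (z ++ y) = toBlocks κ K p (z ++ b.map Symb.nt) ++ o := by
  suffices h : ∃ (o : List (Symb (BlockNT κ K) T)) (b : List N), b.length ≤ ntCount y ∧
      ∀ p, toBlocks κ K p y = toBlocks κ K p (b.map Symb.nt) ++ o by
    obtain ⟨o, b, hb, h⟩ := h
    refine ⟨o, b, hb, fun p z => ?_⟩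
    obtain ⟨o', q, -, h'⟩ := exists_toBlocks_append_left κ K p z
    simp [h', h]
  induction y with
  | nil => exact ⟨[], [], by simp, fun p => by simp⟩
  | cons s y ih =>
    cases s with
    | nt A =>
      obtain ⟨o, b, hb, h⟩ := ih
      exact ⟨o, A :: b, by simp [ntCount]; omega, fun p => by simp [toBlocks, h]⟩
    | tm t =>
      exact ⟨Symb.tm t :: toBlocks κ K [] y, [], by simp, fun p => by simp [toBlocks]⟩

/-- The matrices of the block grammar. -/
inductive BlockMat (G : GSG N T) (κ : N → ℕ) (K : ℕ) :
    List (BlockNT κ K × List (Symb (BlockNT κ K) T)) → Prop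
  | init (q : Set.Iic κ) (hq : ∀ A, q.1 A = symCount A [(Symb.nt G.start : Symb N T)])
      (hK : 1 ≤ K) :
      BlockMat G κ K
        [(none, Symb.nt (ctlSym q) :: toBlocks κ K [] [Symb.nt G.start])]
  | step (q q' : Set.Iic κ) (r) (hr : r ∈ G.rules) (p b : List N)
      (hl : (p ++ (r.1.1 :: r.1.2) ++ b).length ≤ K)
      (hK : p.length + ntCount r.2 + b.length ≤ K)
      (hq : ∀ A, q'.1 A + symCount A ((r.1.1 :: r.1.2).map Symb.nt : List (Symb N T)) =
        q.1 A + symCount A r.2) :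
      BlockMat G κ K
        [(ctlSym q, [Symb.nt (ctlSym q')]),
          (blockSym ⟨p ++ (r.1.1 :: r.1.2) ++ b, hl⟩,
            toBlocks κ K [] (p.map Symb.nt ++ r.2 ++ b.map Symb.nt))]
  | finish (q : Set.Iic κ) : BlockMat G κ K [(ctlSym q, [])]

theorem finite_setOf_blockMat [Fintype N] (G : GSG N T) (κ : N → ℕ) (K : ℕ) :
    {m | BlockMat G κ K m}.Finite := by
  classical
  have : Finite {l : List N // l.length ≤ K} := List.finite_length_le N K
  refine Set.Finite.subset
    (((Set.finite_range fun q : Set.Iic κ =>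
        [((none : BlockNT κ K), Symb.nt (ctlSym q) :: toBlocks κ K [] [Symb.nt G.start])]).union
      (Set.finite_range fun x : Set.Iic κ × Set.Iic κ × G.rules × {l : List N // l.length ≤ K} ×
          {l : List N // l.length ≤ K} × {l : List N // l.length ≤ K} =>
        [(ctlSym x.1, [Symb.nt (ctlSym x.2.1)]),
          (blockSym x.2.2.2.1, toBlocks κ K []
            (x.2.2.2.2.1.1.map Symb.nt ++ x.2.2.1.1.2 ++ x.2.2.2.2.2.1.map Symb.nt))])).union
      (Set.finite_range fun q : Set.Iic κ => [((ctlSym q : BlockNT κ K), [])])) ?_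
  rintro m (⟨q, hq, hK⟩ | ⟨q, q', r, hr, p, b, hl, hK, hq⟩ | ⟨q⟩)
  · exact .inl (.inl ⟨q, rfl⟩)
  · exact .inl (.inr ⟨(q, q', ⟨r, hr⟩, ⟨_, hl⟩, ⟨p, by omega⟩, ⟨b, by omega⟩), rfl⟩)
  · exact .inr ⟨q, rfl⟩

/-- The block grammar. -/
noncomputable def blockGrammar [Fintype N] (G : GSG N T) (κ : N → ℕ) (K : ℕ) :
    MG (BlockNT κ K) T where
  start := none
  mats := (finite_setOf_blockMat G κ K).toFinset

theorem mem_mats_blockGrammar [Fintype N] {G : GSG N T} {κ : N → ℕ} {K : ℕ}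
    {m : List (BlockNT κ K × List (Symb (BlockNT κ K) T))} :
    m ∈ (blockGrammar G κ K).mats ↔ BlockMat G κ K m := by
  simp [blockGrammar]

/-- Invariant of the block grammar between two matrices. -/
def BlockInv (G : GSG N T) (κ : N → ℕ) (K : ℕ) (v : List (Symb (BlockNT κ K) T)) : Prop :=
  v = [Symb.nt none] ∨
  (∃ (q : Set.Iic κ) (w : List (Symb (BlockNT κ K) T)), v = Symb.nt (ctlSym q) :: w ∧
    IsBlockWord w ∧ (∀ A, q.1 A = symCount A (unblock w)) ∧
    Relation.ReflTransGen (G.CapStep κ) [Symb.nt G.start] (unblock w)) ∨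
  (IsBlockWord v ∧ Relation.ReflTransGen (G.CapStep κ) [Symb.nt G.start] (unblock v))

theorem not_applyRule_of_notMem {r : N × List (Symb N T)} {u v : List (Symb N T)}
    (h : Symb.nt r.1 ∉ u) : ¬ applyRule r u v := by
  rintro ⟨x, y, rfl, -⟩
  simp at h

theorem applyRule_head {r : N × List (Symb N T)} {u v : List (Symb N T)}
    (h : Symb.nt r.1 ∉ u) {A : N} (hr : applyRule r (Symb.nt A :: u) v) :
    A = r.1 ∧ v = r.2 ++ u := by
  obtain ⟨x, y, hxy, rfl⟩ := hr
  rcases x with _ | ⟨s, x⟩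
  · simp_all
  · simp only [List.cons_append, List.cons.injEq] at hxy
    simp [hxy.2] at h

theorem applyRule_tail {r : N × List (Symb N T)} {u v : List (Symb N T)} {A : N} (hA : A ≠ r.1)
    (hr : applyRule r (Symb.nt A :: u) v) : ∃ v', v = Symb.nt A :: v' ∧ applyRule r u v' := by
  obtain ⟨x, y, hxy, rfl⟩ := hr
  rcases x with _ | ⟨s, x⟩
  · simp_all
  · simp only [List.cons_append, List.cons.injEq] at hxy
    exact ⟨x ++ r.2 ++ y, by simp [hxy.1], x, y, hxy.2, rfl⟩

theorem IsBlockWord.none_notMem {w : List (Symb (BlockNT κ K) T)} (h : IsBlockWord w) :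
    Symb.nt none ∉ w := fun hm => by
  obtain ⟨B, hB⟩ := h _ hm
  simp [blockSym] at hB

theorem IsBlockWord.ctlSym_notMem {w : List (Symb (BlockNT κ K) T)} (h : IsBlockWord w)
    (q : Set.Iic κ) : Symb.nt (ctlSym q) ∉ w := fun hm => by
  obtain ⟨B, hB⟩ := h _ hm
  simp [blockSym, ctlSym] at hB

theorem BlockInv.of_blockMat {G : GSG N T} {v v' : List (Symb (BlockNT κ K) T)}
    {m : List (BlockNT κ K × List (Symb (BlockNT κ K) T))}
    (hv : BlockInv G κ K v) (hm : BlockMat G κ K m) (h : DerivP (fun _ => True) m v v') :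
    BlockInv G κ K v' := by
  cases hm with
  | init q hq hK =>
    cases h with | cons _ hr h => cases h with | nil _ _ =>
    rcases hv with rfl | ⟨q', w, rfl, hw, -, -⟩ | ⟨hw, -⟩
    · obtain ⟨-, rfl⟩ := applyRule_head (by simp) hr
      refine .inr (.inl ⟨q, _, List.append_nil _, isBlockWord_toBlocks _ _, ?_, ?_⟩)
      · simpa [unblock_toBlocks (κ := κ) (K := K) (p := []) (u := [Symb.nt G.start])
          (by simpa [ntCount] using hK)] using hq
      · rw [unblock_toBlocks (by simpa [ntCount] using hK)]
        exact .refl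
    · exact absurd hr (not_applyRule_of_notMem (by simpa [ctlSym] using hw.none_notMem))
    · exact absurd hr (not_applyRule_of_notMem hw.none_notMem)
  | step q q' r hmem p b hl hK hq =>
    cases h with | cons _ hr h => cases h with | cons _ hr' h => cases h with | nil _ _ =>
    rcases hv with rfl | ⟨q₀, w, rfl, hw, hq₀, hreach⟩ | ⟨hw, -⟩
    · exact absurd hr (not_applyRule_of_notMem (by simp [ctlSym]))
    · obtain ⟨h₁, rfl⟩ := applyRule_head (hw.ctlSym_notMem q) hr
      obtain rfl : q₀ = q := by simpa [ctlSym] using h₁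
      obtain ⟨w', rfl, x, y, rfl, rfl⟩ := applyRule_tail (by simp [ctlSym, blockSym]) hr'
      have hu : unblock (toBlocks κ K [] (p.map Symb.nt ++ r.2 ++ b.map Symb.nt)) =
          p.map Symb.nt ++ r.2 ++ b.map Symb.nt := by
        rw [unblock_toBlocks (by simpa [ntCount_append, ntCount_map_nt, Nat.add_assoc] using hK)]
        simp
      refine .inr (.inl ⟨q', _, rfl, ?_, ?_, hreach.tail ⟨⟨r, hmem,
        unblock x ++ p.map Symb.nt, b.map Symb.nt ++ unblock y, ?_, ?_⟩, ?_, ?_⟩⟩)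
      · intro A hA
        rw [List.mem_append, List.mem_append] at hA
        rcases hA with (hA | hA) | hA
        · exact hw A (by simp [hA])
        · exact isBlockWord_toBlocks _ _ A hA
        · exact hw A (by simp [hA])
      · intro A
        have h₁ := hq A
        have h₂ := hq₀ A
        simp only [unblock_append, unblock_blockSym, hu, symCount_append, List.map_append]
          at h₁ h₂ ⊢
        omega
      · simp [unblock_append, unblock_blockSym]
      · simp only [unblock_append]
        rw [hu]
        simp
      · exact fun A => hq₀ A ▸ q₀.2 A
      · intro A
        have h₀ : q'.1 A ≤ κ A := q'.2 A
        have h₁ := hq A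
        have h₂ := hq₀ A
        simp only [unblock_append, unblock_blockSym, hu, symCount_append, List.map_append]
          at h₁ h₂ ⊢
        omega
    · exact absurd hr (not_applyRule_of_notMem (hw.ctlSym_notMem q))
  | finish q =>
    cases h with | cons _ hr h => cases h with | nil _ _ =>
    rcases hv with rfl | ⟨q₀, w, rfl, hw, hq₀, hreach⟩ | ⟨hw, -⟩
    · exact absurd hr (not_applyRule_of_notMem (by simp [ctlSym]))
    · obtain ⟨-, rfl⟩ := applyRule_head (hw.ctlSym_notMem q) hr
      exact .inr (.inr ⟨hw, hreach⟩)
    · exact absurd hr (not_applyRule_of_notMem (hw.ctlSym_notMem q))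

theorem blockGrammar_Lang_subset [Fintype N] (G : GSG N T) (κ : N → ℕ) (K : ℕ) :
    (blockGrammar G κ K).Lang ⊆ G.CapLang κ := by
  rintro w ⟨ms, hms, h⟩
  have key : ∀ ms : List (List (BlockNT κ K × List (Symb (BlockNT κ K) T))),
      (∀ m ∈ ms, m ∈ (blockGrammar G κ K).mats) → ∀ v v', BlockInv G κ K v →
      DerivP (fun _ => True) ms.flatten v v' → BlockInv G κ K v' := by
    intro ms
    induction ms with
    | nil =>
      intro _ v v' hv h
      cases h
      exact hv
    | cons m ms ih =>
      intro hms v v' hv h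
      obtain ⟨v₁, h₁, h₂⟩ := DerivP.exists_of_append (by simpa using h)
      exact ih (fun m' hm' => hms m' (by simp [hm'])) v₁ v'
        (hv.of_blockMat (mem_mats_blockGrammar.1 (hms m (by simp))) h₁) h₂
  rcases key ms hms _ _ (.inl rfl) h with h | ⟨q, w', h, -⟩ | ⟨-, h⟩
  · exact absurd (h ▸ List.mem_singleton_self _) (nt_notMem_map_tm none w)
  · exact absurd (h ▸ List.mem_cons_self) (nt_notMem_map_tm (ctlSym q) w)
  · rwa [unblock_map_tm] at h

theorem exists_blockMat_of_capStep [Fintype N] {G : GSG N T} {u v : List (Symb N T)}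
    (h : G.CapStep κ u v) :
    ∃ m, BlockMat G κ (∑ A, κ A) m ∧
      DerivP (fun w => ntCount w ≤ ∑ A, κ A + 1) m
        (Symb.nt (ctlSym ⟨fun A => symCount A u, h.2.1⟩) :: toBlocks κ _ [] u)
        (Symb.nt (ctlSym ⟨fun A => symCount A v, h.2.2⟩) :: toBlocks κ _ [] v) := by
  obtain ⟨⟨r, hr, x, y, hu, hv⟩, hcu, hcv⟩ := h
  have hKu := hcu.ntCount_le
  have hKv := hcv.ntCount_le
  set K := ∑ A, κ A
  obtain ⟨o₁, p, hp, h₁⟩ := exists_toBlocks_append_left κ K [] x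
  obtain ⟨o₂, b, hb, h₂⟩ := exists_toBlocks_append_right κ K y
  have hbu : toBlocks κ K [] u = o₁ ++ blockWord κ K (p ++ (r.1.1 :: r.1.2) ++ b) ++ o₂ := by
    rw [hu, List.append_assoc, h₁, h₂, ← List.map_append, toBlocks_map_nt]
    simp
  have hbv : toBlocks κ K [] v =
      o₁ ++ toBlocks κ K [] (p.map Symb.nt ++ r.2 ++ b.map Symb.nt) ++ o₂ := by
    rw [hv, List.append_assoc, h₁, h₂, List.append_assoc _ r.2, toBlocks_map_nt_append]
    simp
  have hcount : ∀ A, symCount A v + symCount A ((r.1.1 :: r.1.2).map Symb.nt : List (Symb N T)) =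
      symCount A u + symCount A r.2 := by
    intro A
    simp only [hu, hv, symCount_append]
    omega
  have hntu := congrArg ntCount hu
  have hntv := congrArg ntCount hv
  simp only [ntCount_append, ntCount_map_nt] at hntu hntv
  have hl : (p ++ (r.1.1 :: r.1.2) ++ b).length ≤ K := by
    simp only [List.length_append, List.length_nil] at hp ⊢
    omega
  have hrhs : p.length + ntCount r.2 + b.length ≤ K := by
    simp only [List.length_nil] at hp
    omega
  have hblock : blockWord κ K (p ++ (r.1.1 :: r.1.2) ++ b) =
      [(Symb.nt (blockSym ⟨_, hl⟩) : Symb (BlockNT κ K) T)] := by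
    unfold blockWord
    rw [dif_pos ⟨by simp, hl⟩]
  have hcount_u := ntCount_toBlocks_le (κ := κ) (K := K) [] u
  have hcount_v := ntCount_toBlocks_le (κ := κ) (K := K) [] v
  simp only [List.length_nil] at hcount_u hcount_v
  refine ⟨_, .step ⟨_, hcu⟩ ⟨_, hcv⟩ r hr p b hl hrhs hcount,
    .cons ?_ ⟨[], _, rfl, rfl⟩ (.cons ?_ ⟨Symb.nt (ctlSym ⟨_, hcv⟩) :: o₁, o₂, ?_, ?_⟩ (.nil _ ?_))⟩
  · simp only [ntCount]; omega
  · simp only [List.nil_append, List.singleton_append, ntCount]; omega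
  · rw [hbu, hblock]; simp
  · simp [hbv]
  · simp only [ntCount]; omega

theorem CapLang_subset_blockGrammar_FinLang [Fintype N] (G : GSG N T) (κ : N → ℕ) :
    G.CapLang κ ⊆ (blockGrammar G κ (∑ A, κ A)).FinLang (∑ A, κ A + 1) := by
  intro w hw
  have key : ∀ u, Relation.ReflTransGen (G.CapStep κ) u (w.map Symb.tm) → ∀ hu : CapOK κ u,
      ∃ ms : List (List _), (∀ m ∈ ms, BlockMat G κ (∑ A, κ A) m) ∧
        DerivP (fun v => ntCount v ≤ ∑ A, κ A + 1) ms.flatten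
          (Symb.nt (ctlSym ⟨fun A => symCount A u, hu⟩) :: toBlocks κ _ [] u)
          (w.map Symb.tm) := by
    intro u h
    induction h using Relation.ReflTransGen.head_induction_on with
    | refl =>
      intro hu
      refine ⟨[_], List.forall_mem_singleton.2 (.finish ⟨_, hu⟩), .cons ?_ ⟨[], _, rfl, rfl⟩ ?_⟩
      · have := ntCount_toBlocks_le (κ := κ) (K := ∑ A, κ A) []
          (w.map Symb.tm : List (Symb N T))
        simp only [List.length_nil, ntCount_map_tm] at this
        simp only [ntCount]; omega
      · have : toBlocks κ (∑ A, κ A) [] (w.map Symb.tm : List (Symb N T)) = w.map Symb.tm := by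
          clear hw hu
          induction w with
          | nil => simp [toBlocks, blockWord]
          | cons t w ih => simp [toBlocks, blockWord, ih]
        simp only [List.nil_append, this]
        exact .nil _ (by simp [ntCount_map_tm])
    | head h _ ih =>
      intro hu
      obtain ⟨m, hm, h₁⟩ := exists_blockMat_of_capStep h
      obtain ⟨ms, hms, h₂⟩ := ih h.2.2
      exact ⟨m :: ms, List.forall_mem_cons.2 ⟨hm, hms⟩, by simpa using h₁.append h₂⟩
  rcases hw.cases_head with h | ⟨v, h, -⟩
  · exact absurd (h ▸ List.mem_singleton_self _) (nt_notMem_map_tm G.start w)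
  · have hcap := h.2.1
    have hK : 1 ≤ ∑ A, κ A := by simpa [ntCount] using hcap.ntCount_le
    obtain ⟨ms, hms, hd⟩ := key _ hw hcap
    have hinit := BlockMat.init (G := G) ⟨_, hcap⟩ (fun _ => rfl) hK
    refine ⟨_ :: ms, fun m hm =>
      mem_mats_blockGrammar.2 (List.forall_mem_cons.2 ⟨hinit, hms⟩ m hm),
      .cons (by simp [ntCount]) ⟨[], [], rfl, rfl⟩ ?_⟩
    simpa using hd

end Blocks

theorem GScb_subset_MATfin (T : Type) : GScb T ⊆ MATfin T := by
  classical
  rintro L ⟨N, _, G, κ, rfl⟩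
  have : Finite {l : List N // l.length ≤ ∑ A, κ A} := List.finite_length_le N _
  have h₁ := blockGrammar_Lang_subset G κ (∑ A, κ A)
  have h₂ := CapLang_subset_blockGrammar_FinLang G κ
  exact ⟨_, Fintype.ofFinite _, _, _,
    (h₂.trans (MG.FinLang_subset_Lang _ _)).antisymm h₁, h₁.trans h₂⟩

/-! ### Restricting a grammar to finitely many nonterminals -/

/-- Rename the nonterminals of a symbol. -/
def Symb.mapNT {N N' T : Type} (f : N → N') : Symb N T → Symb N' T
  | .nt A => .nt (f A)
  | .tm t => .tm t

section Restrict

variable {N' : Type}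

theorem mapNT_injective {f : N → N'} (hf : Function.Injective f) :
    Function.Injective (Symb.mapNT f : Symb N T → Symb N' T) := by
  rintro (A | t) (B | s) h <;> simp_all [Symb.mapNT, hf.eq_iff]

theorem symCount_map_mapNT {f : N → N'} (hf : Function.Injective f) (A : N)
    (u : List (Symb N T)) : symCount (f A) (u.map (Symb.mapNT f)) = symCount A u := by
  induction u with
  | nil => rfl
  | cons s u ih =>
    cases s with
    | nt B => by_cases h : B = A <;> simp [symCount, Symb.mapNT, ih, hf.eq_iff, h]
    | tm t => simp [symCount, Symb.mapNT, ih]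

theorem symCount_map_mapNT_of_notMem {f : N → N'} {B : N'} (hB : B ∉ Set.range f)
    (u : List (Symb N T)) : symCount B (u.map (Symb.mapNT f)) = 0 := by
  induction u with
  | nil => rfl
  | cons s u ih =>
    cases s with
    | nt A => simp [symCount, Symb.mapNT, ih, show f A ≠ B from fun h => hB ⟨A, h⟩]
    | tm t => simp [symCount, Symb.mapNT, ih]

theorem capOK_map_mapNT_iff {f : N → N'} (hf : Function.Injective f) {κ : N' → ℕ}
    {u : List (Symb N T)} : CapOK κ (u.map (Symb.mapNT f)) ↔ CapOK (κ ∘ f) u := by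
  refine ⟨fun h A => symCount_map_mapNT hf A u ▸ h (f A), fun h B => ?_⟩
  by_cases hB : B ∈ Set.range f
  · obtain ⟨A, rfl⟩ := hB
    exact (symCount_map_mapNT hf A u).trans_le (h A)
  · simp [symCount_map_mapNT_of_notMem hB]

theorem map_mapNT_map_nt (f : N → N') (l : List N) :
    (l.map Symb.nt : List (Symb N T)).map (Symb.mapNT f) = (l.map f).map Symb.nt := by
  simp [Symb.mapNT]

theorem map_mapNT_map_tm (f : N → N') (w : List T) :
    (w.map Symb.tm : List (Symb N T)).map (Symb.mapNT f) = w.map Symb.tm := by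
  simp [Symb.mapNT]

theorem exists_map_mapNT_val {F : Set N} {u : List (Symb N T)}
    (h : ∀ A, Symb.nt A ∈ u → A ∈ F) :
    ∃ u' : List (Symb F T), u'.map (Symb.mapNT Subtype.val) = u := by
  induction u with
  | nil => exact ⟨[], rfl⟩
  | cons s u ih =>
    obtain ⟨u', rfl⟩ := ih fun A hA => h A (List.mem_cons_of_mem _ hA)
    cases s with
    | nt A => exact ⟨Symb.nt ⟨A, h A List.mem_cons_self⟩ :: u', rfl⟩
    | tm t => exact ⟨Symb.tm t :: u', rfl⟩

/-- Rename the nonterminals of a rule. -/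
def mapRule (f : N → N') (r : (N × List N) × List (Symb N T)) :
    (N' × List N') × List (Symb N' T) :=
  ((f r.1.1, r.1.2.map f), r.2.map (Symb.mapNT f))

theorem mapRule_injective {f : N → N'} (hf : Function.Injective f) :
    Function.Injective (mapRule f : (N × List N) × List (Symb N T) → _) := by
  rintro ⟨⟨A, l⟩, u⟩ ⟨⟨B, m⟩, v⟩ h
  simp only [mapRule, Prod.mk.injEq, hf.eq_iff, hf.list_map.eq_iff,
    (mapNT_injective hf).list_map.eq_iff] at h ⊢
  exact h

/-- The restriction of a grammar along an injective renaming. -/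
noncomputable def GSG.comap (G : GSG N' T) {f : N → N'} (hf : Function.Injective f) (S : N) :
    GSG N T where
  start := S
  rules := G.rules.preimage (mapRule f) (mapRule_injective hf).injOn

theorem GSG.comap_capLang {G : GSG N' T} {f : N → N'} (hf : Function.Injective f) {S : N}
    (hS : f S = G.start) (hG : ∀ r ∈ G.rules, r ∈ Set.range (mapRule f)) (κ : N' → ℕ) :
    (G.comap hf S).CapLang (κ ∘ f) = G.CapLang κ := by
  ext w
  constructor
  · intro h
    replace h : Relation.ReflTransGen ((G.comap hf S).CapStep (κ ∘ f)) [Symb.nt S]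
      (w.map Symb.tm) := h
    have := Relation.ReflTransGen.lift (p := G.CapStep κ) (List.map (Symb.mapNT f)) ?_ _ _ h
    · rw [Function.onFun, map_mapNT_map_tm] at this
      simpa [CapLang, Symb.mapNT, comap, hS] using this
    · rintro u v ⟨⟨r, hr, x, y, rfl, rfl⟩, hu, hv⟩
      refine ⟨⟨mapRule f r, by simpa [comap] using hr, x.map (Symb.mapNT f),
        y.map (Symb.mapNT f), ?_, ?_⟩, (capOK_map_mapNT_iff hf).2 hu,
        (capOK_map_mapNT_iff hf).2 hv⟩
      · simp [mapRule, Symb.mapNT]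
      · simp [mapRule]
  · intro h
    suffices key : ∀ v, Relation.ReflTransGen (G.CapStep κ) [Symb.nt G.start] v →
        ∃ v', v = v'.map (Symb.mapNT f) ∧
          Relation.ReflTransGen ((G.comap hf S).CapStep (κ ∘ f)) [Symb.nt S] v' by
      obtain ⟨v', hv', h⟩ := key _ h
      rw [← map_mapNT_map_tm f, (mapNT_injective hf).list_map.eq_iff] at hv'
      rw [← hv'] at h
      exact h
    intro v h
    induction h with
    | refl => exact ⟨_, by simp [Symb.mapNT, hS], .refl⟩
    | tail _ h ih =>
      obtain ⟨u', rfl, hu'⟩ := ih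
      obtain ⟨⟨r, hr, x, y, hx, rfl⟩, hu, hv⟩ := h
      obtain ⟨r, rfl⟩ := hG r hr
      obtain ⟨xl, y, rfl, hxl, rfl⟩ := List.map_eq_append_iff.1 hx
      obtain ⟨x, l, rfl, rfl, hl⟩ := List.map_eq_append_iff.1 hxl
      obtain rfl : l = (r.1.1 :: r.1.2).map Symb.nt := by
        rw [← (mapNT_injective hf).list_map.eq_iff, hl, map_mapNT_map_nt]
        rfl
      have he : x.map (Symb.mapNT f) ++ (mapRule f r).2 ++ y.map (Symb.mapNT f) =
          (x ++ r.2 ++ y).map (Symb.mapNT f) := by simp [mapRule]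
      refine ⟨x ++ r.2 ++ y, he, hu'.tail ⟨⟨r, by simpa [comap] using hr, x, y, rfl, rfl⟩,
        (capOK_map_mapNT_iff hf).1 hu, (capOK_map_mapNT_iff hf).1 (he ▸ hv)⟩⟩

end Restrict

theorem GSG.capLang_mem_GScb (G : GSG N T) (κ : N → ℕ) : G.CapLang κ ∈ GScb T := by
  let F : Set N := {G.start} ∪ ⋃ r ∈ G.rules,
    ({A | A ∈ r.1.1 :: r.1.2} ∪ {A | (Symb.nt A : Symb N T) ∈ r.2})
  have hF : F.Finite := (Set.finite_singleton _).union <|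
    G.rules.finite_toSet.biUnion fun r _ => (List.finite_toSet _).union <|
      (List.finite_toSet r.2).preimage fun A _ B _ h => by simpa using h
  have hrules : ∀ r ∈ G.rules, r ∈ Set.range (mapRule (Subtype.val : F → N)) := by
    intro r hr
    have hsub : ∀ A, A ∈ r.1.1 :: r.1.2 ∨ Symb.nt A ∈ r.2 → A ∈ F :=
      fun A hA => .inr (Set.mem_biUnion hr hA)
    obtain ⟨v, hv⟩ := exists_map_mapNT_val (F := F) (u := r.2) fun A hA => hsub A (.inr hA)
    obtain ⟨l, hl⟩ : ∃ l : List F, l.map Subtype.val = r.1.2 :=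
      ⟨r.1.2.attach.map fun A => ⟨A.1, hsub _ (.inl (List.mem_cons_of_mem _ A.2))⟩, by
        rw [List.map_map]
        exact List.attach_map_subtype_val _⟩
    exact ⟨((⟨r.1.1, hsub _ (.inl List.mem_cons_self)⟩, l), v), by simp [mapRule, hv, hl]⟩
  exact ⟨F, hF.fintype, G.comap Subtype.val_injective ⟨G.start, .inl rfl⟩, _,
    (GSG.comap_capLang Subtype.val_injective rfl hrules κ).symm⟩

/-! ### From matrix grammars of finite index to capacity-bounded grammars

The grammar consists of a master at the left end of the sentential form, which
holds a supply of resources, and slaves, each of which is followed by the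
resource it occupies. Every resource is of bounded capacity, hence a slave can
move to a new state only if the master has released the required resource. -/

/-- States of a slave: idle, or in one of three stages of applying a rule. -/
inductive Slave (N T : Type) where
  | idle (A : N)
  | act₁ (r : N × List (Symb N T))
  | act₂ (r : N × List (Symb N T))
  | act₃ (r : N × List (Symb N T))

/-- The resources occupied by the slaves. -/
inductive Resource (N T : Type) where
  | free
  | gate (r : N × List (Symb N T))
  | lock₂
  | lock₃

/-- The resource occupied by a slave. -/
def Slave.res : Slave N T → Resource N T
  | idle _ => .free
  | act₁ r => .gate r
  | act₂ _ => .lock₂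
  | act₃ _ => .lock₃

/-- States of the master: the rule in progress, the rules of the current matrix
that are still to be applied, and the number of free places. -/
inductive Phase (N T : Type) where
  | p₀ (l : List (N × List (Symb N T))) (c : ℕ)
  | p₁ (r : N × List (Symb N T)) (l : List (N × List (Symb N T))) (c : ℕ)
  | p₂ (r : N × List (Symb N T)) (l : List (N × List (Symb N T))) (c : ℕ)
  | p₃ (r : N × List (Symb N T)) (l : List (N × List (Symb N T))) (c : ℕ)

/-- Nonterminals of the simulating grammar. -/
inductive SimNT (N T : Type) where
  | start
  | mst (p : Phase N T)
  | sl (x : Slave N T)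
  | rs (ρ : Resource N T)

/-- A sentential form all of whose nonterminals are idle slaves. -/
def idleWord : List (Symb N T) → List (Symb (Slave N T) T)
  | [] => []
  | Symb.nt A :: u => Symb.nt (.idle A) :: idleWord u
  | Symb.tm t :: u => Symb.tm t :: idleWord u

/-- Put behind each slave the resource occupied by it. -/
def expand : List (Symb (Slave N T) T) → List (Symb (SimNT N T) T)
  | [] => []
  | Symb.nt x :: w => Symb.nt (.sl x) :: Symb.nt (.rs x.res) :: expand w
  | Symb.tm t :: w => Symb.tm t :: expand w

theorem idleWord_append (u v : List (Symb N T)) :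
    idleWord (u ++ v) = idleWord u ++ idleWord v := by
  induction u with
  | nil => rfl
  | cons s u ih => cases s <;> simp [idleWord, ih]

theorem ntCount_idleWord (u : List (Symb N T)) : ntCount (idleWord u) = ntCount u := by
  induction u with
  | nil => rfl
  | cons s u ih => cases s <;> simp [idleWord, ntCount, ih]

theorem expand_append (u v : List (Symb (Slave N T) T)) :
    expand (u ++ v) = expand u ++ expand v := by
  induction u with
  | nil => rfl
  | cons s u ih => cases s <;> simp [expand, ih]

theorem expand_idleWord_map_tm (w : List T) :
    expand (idleWord (w.map Symb.tm : List (Symb N T))) = w.map Symb.tm := by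
  induction w with
  | nil => rfl
  | cons t w ih => simp [idleWord, expand, ih]

theorem symCount_rs_expand_idleWord (ρ : Resource N T) (u : List (Symb N T))
    [Decidable (ρ = .free)] :
    symCount (.rs ρ) (expand (idleWord u)) = if ρ = .free then ntCount u else 0 := by
  induction u with
  | nil => simp [idleWord, expand, symCount, ntCount]
  | cons s u ih =>
    cases s with
    | nt A =>
      rcases eq_or_ne ρ .free with rfl | h
      · simp_all [idleWord, expand, symCount, ntCount, Slave.res]
      · simp [idleWord, expand, symCount, ih, Slave.res, h, h.symm]
    | tm t => simp [idleWord, expand, symCount, ntCount, ih]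

theorem one_le_symCount_rs_expand {x : Slave N T} {w : List (Symb (Slave N T) T)}
    (h : Symb.nt x ∈ w) : 1 ≤ symCount (.rs x.res) (expand w) := by
  obtain ⟨w₁, w₂, rfl⟩ := List.append_of_mem h
  simp [expand_append, symCount_append, expand, symCount]
  omega

theorem symCount_sl_expand_le (x : Slave N T) (w : List (Symb (Slave N T) T)) :
    symCount (.sl x) (expand w) ≤ ntCount w := by
  induction w with
  | nil => simp [expand, symCount]
  | cons s u ih =>
    cases s with
    | nt A =>
      simp only [expand, symCount, ntCount, reduceCtorEq, if_false]
      split_ifs <;> omega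
    | tm t => simpa [expand, symCount, ntCount] using ih

theorem notMem_expand {A : SimNT N T} (h₁ : ∀ x, A ≠ .sl x) (h₂ : ∀ ρ, A ≠ .rs ρ)
    (w : List (Symb (Slave N T) T)) : Symb.nt A ∉ expand w := by
  induction w with
  | nil => simp [expand]
  | cons s u ih => cases s <;> simp_all [expand]

theorem exists_of_expand_eq {x : Slave N T} {w : List (Symb (Slave N T) T)}
    {X Y : List (Symb (SimNT N T) T)}
    (h : expand w = X ++ Symb.nt (.sl x) :: Symb.nt (.rs x.res) :: Y) :
    ∃ w₁ w₂, w = w₁ ++ Symb.nt x :: w₂ ∧ X = expand w₁ ∧ Y = expand w₂ := by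
  induction w generalizing X with
  | nil => simp [expand] at h
  | cons s w ih =>
    cases s with
    | tm t =>
      rcases X with _ | ⟨a, X⟩
      · simp [expand] at h
      · simp only [expand, List.cons_append, List.cons.injEq] at h
        obtain ⟨w₁, w₂, rfl, rfl, rfl⟩ := ih h.2
        exact ⟨Symb.tm t :: w₁, w₂, rfl, by simp [expand, h.1], rfl⟩
    | nt z =>
      rcases X with _ | ⟨a, _ | ⟨b, X⟩⟩
      · simp only [expand, List.nil_append, List.cons.injEq, Symb.nt.injEq, SimNT.sl.injEq] at h
        exact ⟨[], w, by simp [h.1], rfl, h.2.2.symm⟩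
      · simp [expand] at h
      · simp only [expand, List.cons_append, List.cons.injEq] at h
        obtain ⟨w₁, w₂, rfl, rfl, rfl⟩ := ih h.2.2
        exact ⟨Symb.nt z :: w₁, w₂, rfl, by simp [expand, h.1, h.2.1], rfl⟩

theorem exists_of_idleWord_eq {x : Slave N T} {u : List (Symb N T)}
    {w₁ w₂ : List (Symb (Slave N T) T)} (h : idleWord u = w₁ ++ Symb.nt x :: w₂) :
    ∃ A u₁ u₂, x = .idle A ∧ u = u₁ ++ Symb.nt A :: u₂ ∧ w₁ = idleWord u₁ ∧
      w₂ = idleWord u₂ := by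
  induction u generalizing w₁ with
  | nil => simp [idleWord] at h
  | cons s u ih =>
    rcases w₁ with _ | ⟨a, w₁⟩
    · cases s with
      | tm t => simp [idleWord] at h
      | nt A =>
        simp only [idleWord, List.nil_append, List.cons.injEq, Symb.nt.injEq] at h
        exact ⟨A, [], u, h.1.symm, rfl, rfl, h.2.symm⟩
    · have h' : idleWord u = w₁ ++ Symb.nt x :: w₂ := by
        cases s <;> simp only [idleWord, List.cons_append, List.cons.injEq] at h <;> exact h.2
      obtain ⟨A, u₁, u₂, hx, rfl, rfl, rfl⟩ := ih h'
      refine ⟨A, s :: u₁, u₂, hx, rfl, ?_, rfl⟩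
      cases s <;> simp only [idleWord, List.cons_append, List.cons.injEq] at h ⊢ <;>
        simp [h.1]

theorem exists_eq_idle_of_mem {x : Slave N T} {u : List (Symb N T)}
    (h : Symb.nt x ∈ idleWord u) : ∃ A, x = .idle A := by
  obtain ⟨w₁, w₂, h⟩ := List.append_of_mem h
  obtain ⟨A, _, _, hx, _⟩ := exists_of_idleWord_eq h
  exact ⟨A, hx⟩

theorem eq_of_mem_idleWord_append {x y : Slave N T} {u v : List (Symb N T)}
    (h : Symb.nt x ∈ idleWord u ++ Symb.nt y :: idleWord v) (hx : ∀ A, x ≠ .idle A) :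
    x = y := by
  rcases List.mem_append.1 h with h | h
  · exact absurd (exists_eq_idle_of_mem h) (by simpa using hx)
  · rcases List.mem_cons.1 h with h | h
    · simpa using h
    · exact absurd (exists_eq_idle_of_mem h) (by simpa using hx)

theorem eq_of_idleWord_append_eq {x y : Slave N T} {u v : List (Symb N T)}
    {w₁ w₂ : List (Symb (Slave N T) T)}
    (h : idleWord u ++ Symb.nt y :: idleWord v = w₁ ++ Symb.nt x :: w₂)
    (hx : ∀ A, x ≠ .idle A) : x = y ∧ w₁ = idleWord u ∧ w₂ = idleWord v := by
  have hidle : ∀ {u : List (Symb N T)}, Symb.nt x ∉ idleWord u := fun h => by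
    obtain ⟨A, hA⟩ := exists_eq_idle_of_mem h
    exact hx A hA
  rcases List.append_eq_append_iff.1 h with ⟨a, rfl, ha⟩ | ⟨a, ha, ha'⟩
  · rcases a with _ | ⟨b, a⟩
    · simp only [List.nil_append, List.cons.injEq, Symb.nt.injEq] at ha
      exact ⟨ha.1.symm, by simp, ha.2.symm⟩
    · simp only [List.cons_append, List.cons.injEq] at ha
      exact absurd (by simp [ha.2]) (hidle (u := v))
  · rcases a with _ | ⟨b, a⟩
    · simp only [List.nil_append, List.cons.injEq, Symb.nt.injEq] at ha'
      exact ⟨ha'.1, by simp [ha], ha'.2⟩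
    · simp only [List.cons_append, List.cons.injEq] at ha'
      exact absurd (by simp [ha, ha'.1]) (hidle (u := u))

section Simulation

variable (G : MG N T) (K : ℕ)

open Classical in
/-- The rules occurring in the matrices of `G`. -/
noncomputable def MG.ruleSet : Finset (N × List (Symb N T)) := G.mats.biUnion List.toFinset

/-- The rule whose gate has been opened by the master. -/
def Phase.IsOpen : Phase N T → N × List (Symb N T) → Prop
  | p₀ _ _, _ | p₃ _ _ _, _ => False
  | p₁ r _ _, r' | p₂ r _ _, r' => r' = r

/-- The locks held by the master. -/
def Phase.locks : Phase N T → List (Resource N T)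
  | p₀ _ _ | p₁ _ _ _ => [.lock₂, .lock₃]
  | p₂ _ _ _ => [.lock₃]
  | p₃ _ _ _ => []

/-- The number of free places held by the master. -/
def Phase.places : Phase N T → ℕ
  | p₀ _ c | p₁ _ _ c | p₂ _ _ c | p₃ _ _ c => c

/-- Only finitely many phases are relevant. -/
def Phase.Valid : Phase N T → Prop
  | p₀ l c => (l = [] ∨ ∃ m ∈ G.mats, l <:+ m) ∧ c ≤ K
  | p₁ r l c | p₂ r l c | p₃ r l c => (∃ m ∈ G.mats, r :: l <:+ m) ∧ c ≤ K

open Classical in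
/-- The resources held by the master. -/
noncomputable def Phase.held (p : Phase N T) : List (Resource N T) :=
  (G.ruleSet.toList.filter fun r => ¬ p.IsOpen r).map .gate ++ p.locks ++
    List.replicate p.places .free

/-- The master together with the resources held by it. -/
noncomputable def Phase.encode (p : Phase N T) : List (Symb (SimNT N T) T) :=
  Symb.nt (.mst p) :: ((p.held G).map .rs).map Symb.nt

/-- Transitions of the master. -/
inductive Phase.Trans : Phase N T → Phase N T → Prop
  | choose {m c} : m ∈ G.mats → Trans (p₀ [] c) (p₀ m c)
  | activate {r l c} : Trans (p₀ (r :: l) c) (p₁ r l c)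
  | release {r l c} : Trans (p₁ r l c) (p₂ r l (c + 1))
  | acquire {r l c} : Trans (p₂ r l (c + ntCount r.2)) (p₃ r l c)
  | finish {r l c} : Trans (p₃ r l c) (p₀ l c)

/-- Transitions of a slave. -/
inductive Slave.Trans : Slave N T → List (Symb (Slave N T) T) → Prop
  | one {r} : r ∈ G.ruleSet → Trans (idle r.1) [Symb.nt (act₁ r)]
  | two {r} : r ∈ G.ruleSet → Trans (act₁ r) [Symb.nt (act₂ r)]
  | three {r} : r ∈ G.ruleSet → Trans (act₂ r) [Symb.nt (act₃ r)]
  | four {r} : r ∈ G.ruleSet → Trans (act₃ r) (idleWord r.2)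

/-- The initial sentential form, in which `k` places are free. -/
noncomputable def simInit (k : ℕ) : List (Symb (SimNT N T) T) :=
  (Phase.p₀ [] k).encode G ++ expand (idleWord [Symb.nt G.start])

/-- The rules of the simulating grammar. -/
inductive SimRule : (SimNT N T × List (SimNT N T)) × List (Symb (SimNT N T) T) → Prop
  | init {k} : k + 1 = K → SimRule ((.start, []), simInit G k)
  | mst {p p'} : Phase.Trans G p p' → p.Valid G K → p'.Valid G K →
      SimRule ((.mst p, (p.held G).map .rs), p'.encode G)
  | fin : SimRule ((.mst (.p₀ [] K), ((Phase.p₀ [] K).held G).map .rs), [])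
  | sl {x β} : Slave.Trans G x β → SimRule ((.sl x, [.rs x.res]), expand β)

variable {G K}

theorem MG.mem_ruleSet {r : N × List (Symb N T)} :
    r ∈ G.ruleSet ↔ ∃ m ∈ G.mats, r ∈ m := by
  simp [ruleSet]

variable (G K)

theorem finite_setOf_valid : {p : Phase N T | p.Valid G K}.Finite := by
  have hl : {l | ∃ m ∈ G.mats, l <:+ m}.Finite := by
    have : {l | ∃ m ∈ G.mats, l <:+ m} = ⋃ m ∈ G.mats, {l | l ∈ m.tails} := by
      ext l
      simp
    rw [this]
    exact G.mats.finite_toSet.biUnion fun m _ => List.finite_toSet _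
  have hl' : ({l | ∃ m ∈ G.mats, l <:+ m} ∪ {[]}).Finite := hl.union (Set.finite_singleton _)
  have hr := G.ruleSet.finite_toSet
  have hc := Set.finite_Iic K
  have h₃ := (hr.prod (hl'.prod hc))
  refine ((hl'.prod hc).image fun q => Phase.p₀ q.1 q.2).union
    ((h₃.image fun q => Phase.p₁ q.1 q.2.1 q.2.2).union
      ((h₃.image fun q => Phase.p₂ q.1 q.2.1 q.2.2).union
        (h₃.image fun q => Phase.p₃ q.1 q.2.1 q.2.2))) |>.subset ?_
  have key : ∀ {r : N × List (Symb N T)} {l c}, (∃ m ∈ G.mats, r :: l <:+ m) ∧ c ≤ K →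
      (r, l, c) ∈ (G.ruleSet : Set (N × List (Symb N T))) ×ˢ
        (({l | ∃ m ∈ G.mats, l <:+ m} ∪ {[]}) ×ˢ Set.Iic K) := by
    rintro r l c ⟨⟨m, hm, h⟩, hc⟩
    exact ⟨MG.mem_ruleSet.2 ⟨m, hm, h.subset List.mem_cons_self⟩,
      .inl ⟨m, hm, (List.suffix_cons r l).trans h⟩, hc⟩
  rintro (⟨l, c⟩ | ⟨r, l, c⟩ | ⟨r, l, c⟩ | ⟨r, l, c⟩) h
  · exact .inl ⟨(l, c), ⟨h.1.symm, h.2⟩, rfl⟩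
  · exact .inr (.inl ⟨_, key h, rfl⟩)
  · exact .inr (.inr (.inl ⟨_, key h, rfl⟩))
  · exact .inr (.inr (.inr ⟨_, key h, rfl⟩))

theorem finite_setOf_simRule : {r | SimRule G K r}.Finite := by
  have hr := G.ruleSet.finite_toSet
  have hS : {q : Slave N T × List (Symb (Slave N T) T) | Slave.Trans G q.1 q.2}.Finite := by
    refine ((hr.image fun r => (.idle r.1, [Symb.nt (.act₁ r)])).union
      ((hr.image fun r => (.act₁ r, [Symb.nt (.act₂ r)])).union
        ((hr.image fun r => (.act₂ r, [Symb.nt (.act₃ r)])).union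
          (hr.image fun r => (.act₃ r, idleWord r.2))))) |>.subset ?_
    rintro ⟨_, _⟩ (h | h | h | h)
    · exact .inl ⟨_, h, rfl⟩
    · exact .inr (.inl ⟨_, h, rfl⟩)
    · exact .inr (.inr (.inl ⟨_, h, rfl⟩))
    · exact .inr (.inr (.inr ⟨_, h, rfl⟩))
  have hP := (finite_setOf_valid G K).prod (finite_setOf_valid G K)
  refine ((Set.finite_singleton ((.start, []), simInit G (K - 1))).union
    ((hP.image fun q => ((.mst q.1, (q.1.held G).map .rs), q.2.encode G)).union
      ((Set.finite_singleton ((.mst (.p₀ [] K), ((Phase.p₀ [] K).held G).map .rs), [])).union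
        (hS.image fun q => ((.sl q.1, [.rs q.1.res]), expand q.2))))) |>.subset ?_
  rintro _ (h | ⟨_, h, h'⟩ | _ | h)
  · exact .inl (by subst h; rfl)
  · exact .inr (.inl ⟨(_, _), ⟨h, h'⟩, rfl⟩)
  · exact .inr (.inr (.inl rfl))
  · exact .inr (.inr (.inr ⟨(_, _), h, rfl⟩))

/-- The grammar simulating `G`. -/
noncomputable def simGrammar : GSG (SimNT N T) T where
  start := .start
  rules := (finite_setOf_simRule G K).toFinset

/-- The capacities of the simulating grammar. -/
def simCap : SimNT N T → ℕ
  | .sl _ | .rs .free => K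
  | _ => 1

variable {G K}

theorem symCount_mst_encode_le (p q : Phase N T) :
    symCount (.mst q) (p.encode G) ≤ 1 := by
  classical
  simp only [Phase.encode, symCount, symCount_map_nt]
  rw [List.count_eq_zero_of_not_mem (by simp)]
  split_ifs <;> simp

theorem mem_encode {p : Phase N T} {A : SimNT N T} (h : Symb.nt A ∈ p.encode G) :
    A = .mst p ∨ ∃ ρ, A = .rs ρ := by
  simp only [Phase.encode, List.mem_cons, Symb.nt.injEq, List.mem_map] at h
  rcases h with h | ⟨_, ⟨ρ, _, rfl⟩, h⟩
  · exact .inl h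
  · exact .inr ⟨ρ, by simpa using h.symm⟩

open Classical in
theorem symCount_rs_encode (p : Phase N T) (ρ : Resource N T) :
    symCount (.rs ρ) (p.encode G) = (p.held G).count ρ := by
  rw [Phase.encode, symCount, if_neg (by simp), zero_add, symCount_map_nt]
  convert List.count_map_of_injective (p.held G) SimNT.rs (fun _ _ h => by simpa using h) ρ

theorem symCount_free_encode (p : Phase N T) :
    symCount (.rs .free) (p.encode G) = p.places := by
  classical
  rw [symCount_rs_encode, Phase.held, List.count_append, List.count_append,
    List.count_eq_zero_of_not_mem (by simp), List.count_eq_zero_of_not_mem (l := p.locks)]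
  · simp
  · cases p <;> simp [Phase.locks]

open Classical in
theorem symCount_gate_encode (p : Phase N T) (r : N × List (Symb N T)) :
    symCount (.rs (.gate r)) (p.encode G) =
      (G.ruleSet.toList.filter fun r => ¬ p.IsOpen r).count r := by
  have hl : Resource.gate r ∉ p.locks := by cases p <;> simp [Phase.locks]
  rw [symCount_rs_encode, Phase.held, List.count_append, List.count_append,
    List.count_eq_zero_of_not_mem hl, List.count_eq_zero_of_not_mem (l := List.replicate _ _)]
  · exact List.count_map_of_injective _ Resource.gate (fun _ _ h => by simpa using h) r
  · simp [List.mem_replicate]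

theorem symCount_gate_encode_le (p : Phase N T) (r : N × List (Symb N T)) :
    symCount (.rs (.gate r)) (p.encode G) ≤ 1 := by
  classical
  rw [symCount_gate_encode]
  exact List.nodup_iff_count_le_one.1 ((Finset.nodup_toList _).filter _) r

theorem symCount_gate_encode_of_isOpen {p : Phase N T} {r : N × List (Symb N T)}
    (h : p.IsOpen r) : symCount (.rs (.gate r)) (p.encode G) = 0 := by
  classical
  rw [symCount_gate_encode]
  exact List.count_eq_zero_of_not_mem (by simp [h])

theorem symCount_gate_encode_of_not_isOpen {p : Phase N T} {r : N × List (Symb N T)}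
    (hr : r ∈ G.ruleSet) (h : ¬ p.IsOpen r) : symCount (.rs (.gate r)) (p.encode G) = 1 := by
  classical
  rw [symCount_gate_encode]
  exact List.count_eq_one_of_mem ((Finset.nodup_toList _).filter _) (by simp [h, hr])

open Classical in
theorem symCount_lock_encode (p : Phase N T) {ρ : Resource N T} (hρ : ρ = .lock₂ ∨ ρ = .lock₃) :
    symCount (.rs ρ) (p.encode G) = p.locks.count ρ := by
  rw [symCount_rs_encode, Phase.held, List.count_append, List.count_append,
    List.count_eq_zero_of_not_mem (l := List.map _ _),
    List.count_eq_zero_of_not_mem (l := List.replicate _ _)]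
  · simp
  · rcases hρ with rfl | rfl <;> simp [List.mem_replicate]
  · rcases hρ with rfl | rfl <;> simp

/-- The resources are not overused in the sentential form given by `p` and `w`. -/
def Fits (G : MG N T) (K : ℕ) (p : Phase N T) (w : List (Symb (Slave N T) T)) : Prop :=
  ∀ ρ, symCount (.rs ρ) (p.encode G) + symCount (.rs ρ) (expand w) ≤ simCap K (.rs ρ)

theorem CapOK.fits {p : Phase N T} {w : List (Symb (Slave N T) T)}
    (h : CapOK (simCap K) (p.encode G ++ expand w)) : Fits G K p w := fun ρ => by
  rw [← symCount_append]
  exact h _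

theorem symCount_eq_zero_of_notMem {A : N} {u : List (Symb N T)} (h : Symb.nt A ∉ u) :
    symCount A u = 0 := by
  induction u with
  | nil => rfl
  | cons s u ih => cases s <;> simp_all [symCount, eq_comm]

theorem Fits.capOK {p : Phase N T} {w : List (Symb (Slave N T) T)} (h : Fits G K p w)
    (hw : ntCount w ≤ K) : CapOK (simCap K) (p.encode G ++ expand w) := by
  intro A
  rw [symCount_append]
  cases A with
  | start =>
    rw [symCount_eq_zero_of_notMem fun h => by simpa using mem_encode h,
      symCount_eq_zero_of_notMem (notMem_expand (by simp) (by simp) w)]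
    exact Nat.zero_le _
  | mst q =>
    rw [symCount_eq_zero_of_notMem (notMem_expand (by simp) (by simp) w)]
    exact symCount_mst_encode_le p q
  | sl x =>
    rw [symCount_eq_zero_of_notMem fun h => by simpa using mem_encode h, zero_add]
    exact (symCount_sl_expand_le x w).trans hw
  | rs ρ => exact h ρ

theorem Fits.places_add_le {p : Phase N T} {u : List (Symb N T)} (h : Fits G K p (idleWord u)) :
    p.places + ntCount u ≤ K := by
  classical
  simpa [symCount_free_encode, symCount_rs_expand_idleWord, simCap] using h .free

/-- A non-idle slave excludes any other slave occupying the same resource, and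
the master does not hold this resource. -/
theorem Fits.of_append {p : Phase N T} {x : Slave N T} {w₁ w₂ : List (Symb (Slave N T) T)}
    (h : Fits G K p (w₁ ++ Symb.nt x :: w₂)) (hx : x.res ≠ .free) :
    symCount (.rs x.res) (p.encode G) = 0 ∧
      ∀ y : Slave N T, y.res = x.res → Symb.nt y ∉ w₁ ++ w₂ := by
  have h' := h x.res
  have hcap : simCap K (.rs x.res) = 1 := by
    cases hr : x.res <;> simp_all [simCap]
  simp only [expand_append, expand, symCount_append, symCount, hcap, reduceCtorEq, if_false,
    if_true] at h'
  refine ⟨by omega, fun y hy hmem => ?_⟩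
  have := one_le_symCount_rs_expand hmem
  rw [expand_append, symCount_append, hy] at this
  omega

theorem Fits.isOpen {p : Phase N T} {r : N × List (Symb N T)} {w : List (Symb (Slave N T) T)}
    (h : Fits G K p w) (hr : r ∈ G.ruleSet) (hw : Symb.nt (.act₁ r) ∈ w) : p.IsOpen r := by
  by_contra hp
  obtain ⟨w₁, w₂, rfl⟩ := List.append_of_mem hw
  have h₁ := (h.of_append (by simp [Slave.res])).1
  have h₂ := symCount_gate_encode_of_not_isOpen hr hp
  simp only [Slave.res] at h₁
  omega

theorem Fits.lock₂_notMem {p : Phase N T} {r : N × List (Symb N T)}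
    {w : List (Symb (Slave N T) T)} (h : Fits G K p w) (hw : Symb.nt (.act₂ r) ∈ w) :
    .lock₂ ∉ p.locks := by
  classical
  obtain ⟨w₁, w₂, rfl⟩ := List.append_of_mem hw
  have h₁ := (h.of_append (by simp [Slave.res])).1
  simp only [Slave.res, symCount_lock_encode p (.inl rfl)] at h₁
  exact List.count_eq_zero.1 h₁

theorem Fits.lock₃_notMem {p : Phase N T} {r : N × List (Symb N T)}
    {w : List (Symb (Slave N T) T)} (h : Fits G K p w) (hw : Symb.nt (.act₃ r) ∈ w) :
    .lock₃ ∉ p.locks := by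
  classical
  obtain ⟨w₁, w₂, rfl⟩ := List.append_of_mem hw
  have h₁ := (h.of_append (by simp [Slave.res])).1
  simp only [Slave.res, symCount_lock_encode p (.inr rfl)] at h₁
  exact List.count_eq_zero.1 h₁

theorem simGrammar_step_iff {p : Phase N T} {w : List (Symb (Slave N T) T)}
    {v : List (Symb (SimNT N T) T)} :
    (simGrammar G K).Step (p.encode G ++ expand w) v ↔
      (∃ p', Phase.Trans G p p' ∧ p.Valid G K ∧ p'.Valid G K ∧ v = p'.encode G ++ expand w) ∨
      (p = .p₀ [] K ∧ v = expand w) ∨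
      ∃ x β w₁ w₂, Slave.Trans G x β ∧ w = w₁ ++ Symb.nt x :: w₂ ∧
        v = p.encode G ++ expand (w₁ ++ β ++ w₂) := by
  have hmst : ∀ {q : Phase N T} {l X Y}, p.encode G ++ expand w =
      X ++ ((SimNT.mst q) :: l).map Symb.nt ++ Y → X = [] ∧ p = q := by
    intro q l X Y h
    rcases X with _ | ⟨a, X⟩
    · simp only [Phase.encode, List.map_cons, List.nil_append, List.cons_append, List.cons.injEq,
        Symb.nt.injEq, SimNT.mst.injEq] at h
      exact ⟨rfl, h.1⟩
    · simp only [Phase.encode, List.map_cons, List.cons_append, List.cons.injEq] at h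
      have hmem : Symb.nt (.mst q) ∈ ((p.held G).map SimNT.rs).map Symb.nt ++ expand w := by
        rw [h.2]
        simp
      rcases List.mem_append.1 hmem with h' | h'
      · simp at h'
      · exact absurd h' (notMem_expand (by simp) (by simp) w)
  constructor
  · rintro ⟨r, hr, X, Y, hX, rfl⟩
    replace hr : SimRule G K r := (finite_setOf_simRule G K).mem_toFinset.1 hr
    cases hr with
    | init =>
      have hmem : Symb.nt .start ∈ p.encode G ++ expand w := by simp [hX]
      rcases List.mem_append.1 hmem with h' | h'
      · simpa using mem_encode h'
      · exact absurd h' (notMem_expand (by simp) (by simp) w)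
    | mst ht hp hp' =>
      obtain ⟨rfl, rfl⟩ := hmst hX
      refine .inl ⟨_, ht, hp, hp', ?_⟩
      simpa [Phase.encode] using hX.symm
    | fin =>
      obtain ⟨rfl, rfl⟩ := hmst hX
      refine .inr (.inl ⟨rfl, ?_⟩)
      simpa [Phase.encode] using hX.symm
    | @sl x β ht =>
      right; right
      have hx : Symb.nt (.sl x) ∉ p.encode G := fun h => by simpa using mem_encode h
      simp only [List.append_assoc, List.map_cons, List.map_nil, List.cons_append,
        List.nil_append] at hX
      rcases List.append_eq_append_iff.1 hX with ⟨a, rfl, ha⟩ | ⟨a, ha, ha'⟩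
      · obtain ⟨w₁, w₂, rfl, rfl, rfl⟩ := exists_of_expand_eq ha
        exact ⟨x, β, w₁, w₂, ht, rfl, by simp [expand_append]⟩
      · rcases a with _ | ⟨b, a⟩
        · obtain ⟨w₁, w₂, rfl, h₁, rfl⟩ := exists_of_expand_eq (X := []) (by simpa using ha'.symm)
          refine ⟨x, β, w₁, w₂, ht, rfl, ?_⟩
          simp [expand_append, ← h₁, ha]
        · simp only [List.cons_append, List.cons.injEq] at ha'
          exact absurd (by simp [ha, ha'.1]) hx
  · rintro (⟨p', ht, hp, hp', rfl⟩ | ⟨rfl, rfl⟩ | ⟨x, β, w₁, w₂, ht, rfl, rfl⟩)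
    · exact ⟨_, (finite_setOf_simRule G K).mem_toFinset.2 (.mst ht hp hp'), [], expand w,
        by simp [Phase.encode], by simp⟩
    · exact ⟨_, (finite_setOf_simRule G K).mem_toFinset.2 .fin, [], expand w,
        by simp [Phase.encode], by simp⟩
    · exact ⟨_, (finite_setOf_simRule G K).mem_toFinset.2 (.sl ht), p.encode G ++ expand w₁,
        expand w₂, by simp [expand, expand_append], by simp [expand_append]⟩

/-- Some sequence of matrices of `G` can be applied up to the remaining rules
`l`, with result `u`. -/
def MG.Reaches (G : MG N T) (u : List (Symb N T)) (l : List (N × List (Symb N T))) : Prop :=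
  ∃ (ms : List (List (N × List (Symb N T)))) (π : List (N × List (Symb N T))),
    (∀ m ∈ ms, m ∈ G.mats) ∧ ms.flatten = π ++ l ∧
    DerivP (fun _ => True) π [Symb.nt G.start] u

theorem MG.Reaches.choose {u : List (Symb N T)} {m : List (N × List (Symb N T))}
    (h : G.Reaches u []) (hm : m ∈ G.mats) : G.Reaches u m := by
  obtain ⟨ms, π, hms, hπ, h⟩ := h
  refine ⟨ms ++ [m], π, ?_, by simp [hπ], h⟩
  simpa [or_imp, forall_and, hm] using hms

theorem MG.Reaches.apply {x y : List (Symb N T)} {r : N × List (Symb N T)}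
    {l : List (N × List (Symb N T))} (h : G.Reaches (x ++ Symb.nt r.1 :: y) (r :: l)) :
    G.Reaches (x ++ r.2 ++ y) l := by
  obtain ⟨ms, π, hms, hπ, h⟩ := h
  exact ⟨ms, π ++ [r], hms, by simp [hπ],
    h.append (.cons trivial ⟨x, y, rfl, rfl⟩ (.nil _ trivial))⟩

theorem MG.Reaches.mem_lang {w : List T} (h : G.Reaches (w.map Symb.tm) []) : w ∈ G.Lang := by
  obtain ⟨ms, π, hms, hπ, h⟩ := h
  exact ⟨ms, hms, by simpa [hπ] using h⟩

/-- All slaves are idle, `l` remains to be applied, and `n` places are free. -/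
def AllIdle (G : MG N T) (K n : ℕ) (l : List (N × List (Symb N T)))
    (w : List (Symb (Slave N T) T)) : Prop :=
  ∃ u, w = idleWord u ∧ G.Reaches u l ∧ n + ntCount u = K

/-- Exactly one slave is active, in state `s` and about to apply `r`. -/
def OneActive (G : MG N T) (K n : ℕ) (s : Slave N T) (r : N × List (Symb N T))
    (l : List (N × List (Symb N T))) (w : List (Symb (Slave N T) T)) : Prop :=
  ∃ x y, w = idleWord x ++ Symb.nt s :: idleWord y ∧
    G.Reaches (x ++ Symb.nt r.1 :: y) (r :: l) ∧ n + ntCount x + ntCount y = K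

/-- The invariant of the simulation. -/
def SimInv (G : MG N T) (K : ℕ) : Phase N T → List (Symb (Slave N T) T) → Prop
  | .p₀ l c, w => AllIdle G K c l w
  | .p₁ r l c, w => AllIdle G K c (r :: l) w ∨ OneActive G K (c + 1) (.act₁ r) r l w
  | .p₂ r l c, w => OneActive G K c (.act₁ r) r l w ∨ OneActive G K c (.act₂ r) r l w ∨
      (Symb.nt (.act₁ r) ∈ w ∧ Symb.nt (.act₂ r) ∈ w)
  | .p₃ r l c, w => OneActive G K (c + ntCount r.2) (.act₂ r) r l w ∨
      OneActive G K (c + ntCount r.2) (.act₃ r) r l w ∨ AllIdle G K c l w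

theorem AllIdle.eq_idle {n : ℕ} {l : List (N × List (Symb N T))} {w : List (Symb (Slave N T) T)}
    (h : AllIdle G K n l w) {x : Slave N T} (hx : Symb.nt x ∈ w) : ∃ A, x = .idle A := by
  obtain ⟨u, rfl, -⟩ := h
  exact exists_eq_idle_of_mem hx

theorem OneActive.eq_of_mem {n : ℕ} {s x : Slave N T} {r : N × List (Symb N T)}
    {l : List (N × List (Symb N T))} {w : List (Symb (Slave N T) T)}
    (h : OneActive G K n s r l w) (hx : Symb.nt x ∈ w) (hx' : ∀ A, x ≠ .idle A) : x = s := by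
  obtain ⟨u, v, rfl, -⟩ := h
  exact eq_of_mem_idleWord_append hx hx'

theorem OneActive.mem {n : ℕ} {s : Slave N T} {r : N × List (Symb N T)}
    {l : List (N × List (Symb N T))} {w : List (Symb (Slave N T) T)}
    (h : OneActive G K n s r l w) : Symb.nt s ∈ w := by
  obtain ⟨u, v, rfl, -⟩ := h
  simp

theorem OneActive.replace {n : ℕ} {s s' x : Slave N T} {r : N × List (Symb N T)}
    {l : List (N × List (Symb N T))} {w₁ w₂ : List (Symb (Slave N T) T)}
    (h : OneActive G K n s r l (w₁ ++ Symb.nt x :: w₂)) (hx : ∀ A, x ≠ .idle A) :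
    OneActive G K n s' r l (w₁ ++ Symb.nt s' :: w₂) := by
  obtain ⟨u, v, hw, h⟩ := h
  obtain ⟨-, rfl, rfl⟩ := eq_of_idleWord_append_eq hw.symm hx
  exact ⟨u, v, rfl, h⟩

theorem AllIdle.activate {n : ℕ} {r : N × List (Symb N T)} {s : Slave N T}
    {l : List (N × List (Symb N T))} {w₁ w₂ : List (Symb (Slave N T) T)}
    (h : AllIdle G K n (r :: l) (w₁ ++ Symb.nt (.idle r.1) :: w₂)) :
    OneActive G K (n + 1) s r l (w₁ ++ Symb.nt s :: w₂) := by
  obtain ⟨u, hw, h, hn⟩ := h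
  obtain ⟨A, u₁, u₂, hA, rfl, rfl, rfl⟩ := exists_of_idleWord_eq hw.symm
  obtain rfl : r.1 = A := by simpa using hA
  refine ⟨u₁, u₂, rfl, h, ?_⟩
  rw [ntCount_append, ntCount] at hn
  omega

theorem OneActive.apply {n : ℕ} {s x : Slave N T} {r : N × List (Symb N T)}
    {l : List (N × List (Symb N T))} {w₁ w₂ : List (Symb (Slave N T) T)}
    (h : OneActive G K (n + ntCount r.2) s r l (w₁ ++ Symb.nt x :: w₂))
    (hx : ∀ A, x ≠ .idle A) : AllIdle G K n l (w₁ ++ idleWord r.2 ++ w₂) := by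
  obtain ⟨u, v, hw, h, hn⟩ := h
  obtain ⟨-, rfl, rfl⟩ := eq_of_idleWord_append_eq hw.symm hx
  refine ⟨u ++ r.2 ++ v, by simp [idleWord_append], h.apply, ?_⟩
  rw [ntCount_append, ntCount_append]
  omega

theorem SimInv.of_slaveTrans {p : Phase N T} {x : Slave N T}
    {β w₁ w₂ : List (Symb (Slave N T) T)} (h : SimInv G K p (w₁ ++ Symb.nt x :: w₂))
    (hf : Fits G K p (w₁ ++ Symb.nt x :: w₂)) (hf' : Fits G K p (w₁ ++ β ++ w₂))
    (ht : Slave.Trans G x β) : SimInv G K p (w₁ ++ β ++ w₂) := by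
  have hx : Symb.nt x ∈ w₁ ++ Symb.nt x :: w₂ := by simp
  cases ht with
  | @one r hr =>
    have hmem : ∀ y : Slave N T, (∀ A, y ≠ .idle A) → Symb.nt y ∈ w₁ ++ Symb.nt (.idle r.1) :: w₂ →
        Symb.nt y ∈ w₁ ++ w₂ := by
      intro y hy h
      simpa [hy] using h
    have hsub : ∀ y : Slave N T, Symb.nt y ∈ w₁ ++ w₂ →
        Symb.nt y ∈ w₁ ++ [Symb.nt (.act₁ r)] ++ w₂ := by
      intro y h
      simp only [List.mem_append] at h ⊢
      tauto
    have hnew : Symb.nt (.act₁ r) ∈ w₁ ++ [Symb.nt (.act₁ r)] ++ w₂ := by simp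
    have hopen := hf'.isOpen hr hnew
    rw [List.append_assoc] at hf'
    have hexcl : Symb.nt (.act₁ r) ∉ w₁ ++ Symb.nt (.idle r.1) :: w₂ := fun h =>
      (hf'.of_append (by simp [Slave.res])).2 _ rfl (hmem _ (by simp) h)
    cases p with
    | p₀ => exact hopen.elim
    | p₃ => exact hopen.elim
    | p₁ r' l c =>
      obtain rfl : r = r' := hopen
      rcases h with h | h
      · exact .inr (by simpa using h.activate)
      · exact absurd h.mem hexcl
    | p₂ r' l c =>
      obtain rfl : r = r' := hopen
      rcases h with h | h | h
      · exact absurd h.mem hexcl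
      · exact .inr (.inr ⟨hnew, hsub _ (hmem _ (by simp) h.mem)⟩)
      · exact absurd h.1 hexcl
  | @two r hr =>
    have hlock := hf'.lock₂_notMem (r := r) (by simp)
    rw [List.append_assoc] at hf'
    cases p with
    | p₀ => simp [Phase.locks] at hlock
    | p₁ => simp [Phase.locks] at hlock
    | p₂ r' l c =>
      rcases h with h | h | h
      · obtain rfl : r = r' := by simpa using h.eq_of_mem hx (by simp)
        exact .inr (.inl (by simpa using h.replace (by simp)))
      · exact absurd (h.eq_of_mem hx (by simp)) (by simp)
      · have := (hf'.of_append (by simp [Slave.res])).2 (.act₂ r') rfl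
        exact absurd (by simpa using h.2) this
    | p₃ r' l c => exact (hf.isOpen hr hx).elim
  | @three r hr =>
    have hlock := hf'.lock₃_notMem (r := r) (by simp)
    cases p with
    | p₀ => simp [Phase.locks] at hlock
    | p₁ => simp [Phase.locks] at hlock
    | p₂ => simp [Phase.locks] at hlock
    | p₃ r' l c =>
      rcases h with h | h | h
      · obtain rfl : r = r' := by simpa using h.eq_of_mem hx (by simp)
        exact .inr (.inl (by simpa using h.replace (by simp)))
      · exact absurd (h.eq_of_mem hx (by simp)) (by simp)
      · exact absurd (h.eq_idle hx) (by simp)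
  | @four r hr =>
    have hlock := hf.lock₃_notMem hx
    cases p with
    | p₀ => simp [Phase.locks] at hlock
    | p₁ => simp [Phase.locks] at hlock
    | p₂ => simp [Phase.locks] at hlock
    | p₃ r' l c =>
      rcases h with h | h | h
      · exact absurd (h.eq_of_mem hx (by simp)) (by simp)
      · obtain rfl : r = r' := by simpa using h.eq_of_mem hx (by simp)
        exact .inr (.inr (h.apply (by simp)))
      · exact absurd (h.eq_idle hx) (by simp)

theorem SimInv.of_phaseTrans {p p' : Phase N T} {w : List (Symb (Slave N T) T)}
    (h : SimInv G K p w) (hf' : Fits G K p' w) (hp : p.Valid G K) (ht : Phase.Trans G p p') :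
    SimInv G K p' w := by
  cases ht with
  | choose hm =>
    obtain ⟨u, hu, h, hc⟩ := h
    exact ⟨u, hu, h.choose hm, hc⟩
  | activate => exact .inl h
  | release =>
    rcases h with ⟨u, rfl, -, hu⟩ | h
    · have := hf'.places_add_le
      simp only [Phase.places] at this
      omega
    · exact .inl h
  | @acquire r l c =>
    obtain ⟨⟨m, hm, hl⟩, -⟩ := hp
    have hr : r ∈ G.ruleSet := MG.mem_ruleSet.2 ⟨m, hm, hl.subset List.mem_cons_self⟩
    rcases h with h | h | h
    · exact (hf'.isOpen hr h.mem).elim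
    · exact .inl h
    · exact (hf'.isOpen hr h.1).elim
  | finish =>
    rcases h with h | h | h
    · exact absurd (hf'.lock₂_notMem h.mem) (by simp [Phase.locks])
    · exact absurd (hf'.lock₃_notMem h.mem) (by simp [Phase.locks])
    · exact h

theorem simGrammar_capLang_subset (k : ℕ) :
    (simGrammar G (k + 1)).CapLang (simCap (k + 1)) ⊆ G.Lang := by
  intro w h
  suffices key : ∀ v, Relation.ReflTransGen ((simGrammar G (k + 1)).CapStep (simCap (k + 1)))
      [Symb.nt .start] v → v = [Symb.nt .start] ∨
        (∃ p z, v = p.encode G ++ expand z ∧ SimInv G (k + 1) p z) ∨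
        ∃ w ∈ G.Lang, v = w.map Symb.tm by
    rcases key _ h with h | ⟨p, z, h, -⟩ | ⟨w', hw', h⟩
    · exact absurd (h ▸ List.mem_singleton_self _) (nt_notMem_map_tm _ w)
    · exact (nt_notMem_map_tm (SimNT.mst p) w (h ▸ by simp [Phase.encode])).elim
    · obtain rfl : w = w' := List.map_injective_iff.2 (fun _ _ h => by simpa using h) h
      exact hw'
  intro v h
  induction h with
  | refl => exact .inl rfl
  | @tail u v _ h ih =>
    obtain ⟨hs, hu, hv⟩ := h
    rcases ih with rfl | ⟨p, z, rfl, hI⟩ | ⟨w, -, rfl⟩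
    · obtain ⟨r, hr, X, Y, hX, rfl⟩ := hs
      replace hr : SimRule G (k + 1) r := (finite_setOf_simRule G _).mem_toFinset.1 hr
      have hX' : X = [] ∧ Y = [] ∧ r.1 = (.start, []) := by
        rcases X with _ | ⟨a, X⟩
        · rcases r with ⟨⟨A, l⟩, β⟩
          simp at hX
          simp [hX]
        · simp at hX
      obtain ⟨rfl, rfl, hr'⟩ := hX'
      cases hr with
      | @init k' hk =>
        obtain rfl : k' = k := by omega
        refine .inr (.inl ⟨.p₀ [] k', idleWord [Symb.nt G.start], by simp [simInit], _, rfl, ?_, by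
          simp [ntCount]⟩)
        exact ⟨[], [], by simp, rfl, .nil _ trivial⟩
      | mst => simp at hr'
      | fin => simp at hr'
      | sl => simp at hr'
    · rcases simGrammar_step_iff.1 hs with ⟨p', ht, hp, -, rfl⟩ | ⟨rfl, rfl⟩ |
        ⟨x, β, w₁, w₂, ht, rfl, rfl⟩
      · exact .inr (.inl ⟨p', z, rfl, hI.of_phaseTrans hv.fits hp ht⟩)
      · obtain ⟨u, rfl, hr, hn⟩ := hI
        obtain ⟨w, rfl⟩ := exists_eq_map_tm_of_ntCount_eq_zero (u := u) (by omega)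
        exact .inr (.inr ⟨w, hr.mem_lang, expand_idleWord_map_tm w⟩)
      · exact .inr (.inl ⟨p, _, rfl, hI.of_slaveTrans hu.fits hv.fits ht⟩)
    · obtain ⟨r, _, X, Y, hX, -⟩ := hs
      exact absurd (hX ▸ by simp) (nt_notMem_map_tm r.1.1 w)

theorem symCount_rs_encode_le_one (p : Phase N T) {ρ : Resource N T} (hρ : ρ ≠ .free) :
    symCount (.rs ρ) (p.encode G) ≤ 1 := by
  classical
  cases ρ with
  | free => exact absurd rfl hρ
  | gate r => exact symCount_gate_encode_le p r
  | lock₂ =>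
    rw [symCount_lock_encode p (.inl rfl)]
    cases p <;> simp [Phase.locks]
  | lock₃ =>
    rw [symCount_lock_encode p (.inr rfl)]
    cases p <;> simp [Phase.locks]

theorem fits_idleWord {p : Phase N T} {u : List (Symb N T)} (h : p.places + ntCount u ≤ K) :
    Fits G K p (idleWord u) := by
  classical
  intro ρ
  rw [symCount_rs_expand_idleWord]
  by_cases hρ : ρ = .free
  · simpa [hρ, symCount_free_encode, simCap] using h
  · have hcap : simCap K (.rs ρ) = 1 := by cases ρ <;> simp_all [simCap]
    simpa [hρ, hcap] using symCount_rs_encode_le_one p hρ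

theorem fits_active {p : Phase N T} {s : Slave N T} {x y : List (Symb N T)}
    (hs : s.res ≠ .free) (hp : symCount (.rs s.res) (p.encode G) = 0)
    (h : p.places + ntCount x + ntCount y ≤ K) :
    Fits G K p (idleWord x ++ Symb.nt s :: idleWord y) := by
  classical
  intro ρ
  simp only [expand_append, expand, symCount_append, symCount, reduceCtorEq, if_false,
    symCount_rs_expand_idleWord, SimNT.rs.injEq, zero_add]
  by_cases hρ : ρ = .free
  · subst hρ
    simpa [hs, symCount_free_encode, simCap, ← Nat.add_assoc] using h
  · have hcap : simCap K (.rs ρ) = 1 := by cases ρ <;> simp_all [simCap]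
    have := symCount_rs_encode_le_one (G := G) p hρ
    by_cases h' : s.res = ρ
    · subst h'
      simp [hρ, hp, hcap]
    · simpa [hρ, hcap, h'] using this

theorem simGrammar_capStep_mst {p p' : Phase N T} {w : List (Symb (Slave N T) T)}
    (ht : Phase.Trans G p p') (hp : p.Valid G K) (hp' : p'.Valid G K) (hf : Fits G K p w)
    (hf' : Fits G K p' w) (hw : ntCount w ≤ K) :
    (simGrammar G K).CapStep (simCap K) (p.encode G ++ expand w) (p'.encode G ++ expand w) :=
  ⟨simGrammar_step_iff.2 (.inl ⟨p', ht, hp, hp', rfl⟩), hf.capOK hw, hf'.capOK hw⟩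

theorem simGrammar_capStep_sl {p : Phase N T} {x : Slave N T}
    {β w₁ w₂ : List (Symb (Slave N T) T)} (ht : Slave.Trans G x β)
    (hf : Fits G K p (w₁ ++ Symb.nt x :: w₂)) (hf' : Fits G K p (w₁ ++ β ++ w₂))
    (hw : ntCount (w₁ ++ Symb.nt x :: w₂) ≤ K) (hw' : ntCount (w₁ ++ β ++ w₂) ≤ K) :
    (simGrammar G K).CapStep (simCap K) (p.encode G ++ expand (w₁ ++ Symb.nt x :: w₂))
      (p.encode G ++ expand (w₁ ++ β ++ w₂)) :=
  ⟨simGrammar_step_iff.2 (.inr (.inr ⟨x, β, w₁, w₂, ht, rfl, rfl⟩)), hf.capOK hw, hf'.capOK hw'⟩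

theorem simGrammar_reach_of_applyRule {r : N × List (Symb N T)} {u v : List (Symb N T)}
    {l : List (N × List (Symb N T))} {c c' : ℕ} (hr : applyRule r u v)
    (hl : ∃ m ∈ G.mats, r :: l <:+ m) (hu : c + ntCount u = K) (hc : 1 ≤ c)
    (hv : c' + ntCount v = K) :
    Relation.ReflTransGen ((simGrammar G K).CapStep (simCap K))
      ((Phase.p₀ (r :: l) c).encode G ++ expand (idleWord u))
      ((Phase.p₀ l c').encode G ++ expand (idleWord v)) := by
  classical
  obtain ⟨x, y, rfl, rfl⟩ := hr
  have hrs : r ∈ G.ruleSet := by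
    obtain ⟨m, hm, hl⟩ := hl
    exact MG.mem_ruleSet.2 ⟨m, hm, hl.subset List.mem_cons_self⟩
  have hl' : ∃ m ∈ G.mats, l <:+ m := by
    obtain ⟨m, hm, hl⟩ := hl
    exact ⟨m, hm, (List.suffix_cons r l).trans hl⟩
  simp only [ntCount_append, ntCount] at hu hv
  have hN : ∀ s : Slave N T, ntCount (idleWord x ++ Symb.nt s :: idleWord y) ≤ K := by
    intro s
    simp only [ntCount_append, ntCount, ntCount_idleWord]
    omega
  have hN' : ntCount (idleWord x ++ idleWord r.2 ++ idleWord y) ≤ K := by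
    simp only [ntCount_append, ntCount_idleWord]
    omega
  have hu' : idleWord (x ++ Symb.nt r.1 :: y) =
      idleWord x ++ Symb.nt (.idle r.1) :: idleWord y := by simp [idleWord_append, idleWord]
  have hv' : idleWord (x ++ r.2 ++ y) = idleWord x ++ idleWord r.2 ++ idleWord y := by
    simp [idleWord_append]
  have hidle : ∀ p : Phase N T, p.places = c →
      Fits G K p (idleWord x ++ Symb.nt (.idle r.1) :: idleWord y) := by
    rintro p rfl
    rw [← hu']
    refine fits_idleWord ?_
    simp only [ntCount_append, ntCount]
    omega
  have hidle' : ∀ p : Phase N T, p.places = c' →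
      Fits G K p (idleWord x ++ idleWord r.2 ++ idleWord y) := by
    rintro p rfl
    rw [← hv']
    refine fits_idleWord ?_
    simp only [ntCount_append]
    omega
  have hact₁ : ∀ p : Phase N T, p.places ≤ c + 1 → p.IsOpen r →
      Fits G K p (idleWord x ++ Symb.nt (.act₁ r) :: idleWord y) := fun p hp ho =>
    fits_active (by simp [Slave.res]) (symCount_gate_encode_of_isOpen ho) (by omega)
  have hact₂ : ∀ p : Phase N T, p.places ≤ c + 1 → .lock₂ ∉ p.locks →
      Fits G K p (idleWord x ++ Symb.nt (.act₂ r) :: idleWord y) := fun p hp ho =>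
    fits_active (by simp [Slave.res]) ((symCount_lock_encode p (.inl rfl)).trans
      (List.count_eq_zero.2 ho)) (by omega)
  have hact₃ : ∀ p : Phase N T, p.places ≤ c + 1 → .lock₃ ∉ p.locks →
      Fits G K p (idleWord x ++ Symb.nt (.act₃ r) :: idleWord y) := fun p hp ho =>
    fits_active (by simp [Slave.res]) ((symCount_lock_encode p (.inr rfl)).trans
      (List.count_eq_zero.2 ho)) (by omega)
  have hc₁ : c + 1 = c' + ntCount r.2 := by omega
  have hc₂ : c' ≤ c + 1 := by omega
  rw [hu', hv']
  refine .head (simGrammar_capStep_mst .activate ⟨.inr hl, by omega⟩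
    (p' := .p₁ r l c) ⟨hl, by omega⟩ (hidle _ rfl) (hidle _ rfl) (hN _)) ?_
  refine .head (simGrammar_capStep_sl (.one hrs) (hidle _ rfl)
    (by simpa using hact₁ (.p₁ r l c) (by simp [Phase.places]) rfl) (hN _)
    (by simpa using hN (.act₁ r))) ?_
  rw [List.append_assoc, List.singleton_append]
  refine .head (simGrammar_capStep_mst .release ⟨hl, by omega⟩
    (p' := .p₂ r l (c + 1)) ⟨hl, by omega⟩ (hact₁ _ (by simp [Phase.places]) rfl)
    (hact₁ _ (by simp [Phase.places]) rfl) (hN _)) ?_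
  refine .head (simGrammar_capStep_sl (.two hrs) (hact₁ _ (by simp [Phase.places]) rfl)
    (by simpa using hact₂ (.p₂ r l (c + 1)) (by simp [Phase.places]) (by simp [Phase.locks]))
    (hN _) (by simpa using hN (.act₂ r))) ?_
  rw [List.append_assoc, List.singleton_append, hc₁]
  refine .head (simGrammar_capStep_mst .acquire ⟨hl, by omega⟩
    (p' := .p₃ r l c') ⟨hl, by omega⟩ (hact₂ _ hc₁.ge (by simp [Phase.locks]))
    (hact₂ _ hc₂ (by simp [Phase.locks])) (hN _)) ?_
  refine .head (simGrammar_capStep_sl (.three hrs) (hact₂ _ hc₂ (by simp [Phase.locks]))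
    (by simpa using hact₃ (.p₃ r l c') hc₂ (by simp [Phase.locks]))
    (hN _) (by simpa using hN (.act₃ r))) ?_
  rw [List.append_assoc, List.singleton_append]
  refine .head (simGrammar_capStep_sl (.four hrs) (hact₃ _ hc₂ (by simp [Phase.locks]))
    (hidle' _ rfl) (hN _) hN') ?_
  exact .single (simGrammar_capStep_mst .finish ⟨hl, by omega⟩ ⟨.inr hl', by omega⟩
    (hidle' _ rfl) (hidle' _ rfl) hN')

theorem DerivP.holds_left {P : List (Symb N T) → Prop} {π : List (N × List (Symb N T))}
    {u v : List (Symb N T)} (h : DerivP P π u v) : P u := by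
  cases h <;> assumption

theorem simGrammar_reach_of_derivP {k : ℕ} {l : List (N × List (Symb N T))}
    (hl : ∃ m ∈ G.mats, l <:+ m) {u v : List (Symb N T)}
    (h : DerivP (fun u => ntCount u ≤ k) l u v) :
    Relation.ReflTransGen ((simGrammar G (k + 1)).CapStep (simCap (k + 1)))
      ((Phase.p₀ l (k + 1 - ntCount u)).encode G ++ expand (idleWord u))
      ((Phase.p₀ [] (k + 1 - ntCount v)).encode G ++ expand (idleWord v)) := by
  induction h with
  | nil => exact .refl
  | @cons r l u v _ hu hr h ih =>
    have hv := h.holds_left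
    refine (simGrammar_reach_of_applyRule hr hl (by omega) (by omega) (by omega)).trans (ih ?_)
    obtain ⟨m, hm, hl⟩ := hl
    exact ⟨m, hm, (List.suffix_cons r l).trans hl⟩

theorem simGrammar_reach_of_flatten {k : ℕ} {ms : List (List (N × List (Symb N T)))}
    (hms : ∀ m ∈ ms, m ∈ G.mats) {u v : List (Symb N T)}
    (h : DerivP (fun u => ntCount u ≤ k) ms.flatten u v) :
    Relation.ReflTransGen ((simGrammar G (k + 1)).CapStep (simCap (k + 1)))
      ((Phase.p₀ [] (k + 1 - ntCount u)).encode G ++ expand (idleWord u))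
      ((Phase.p₀ [] (k + 1 - ntCount v)).encode G ++ expand (idleWord v)) := by
  induction ms generalizing u with
  | nil =>
    cases h with
    | nil => exact .refl
  | cons m ms ih =>
    have hm : m ∈ G.mats := hms m List.mem_cons_self
    obtain ⟨z, h₁, h₂⟩ := h.exists_of_append
    have hu := h₁.holds_left
    have hf : ∀ l, Fits G (k + 1) (.p₀ l (k + 1 - ntCount u)) (idleWord u) := fun l =>
      fits_idleWord (by simp only [Phase.places]; omega)
    have hl : ∃ m' ∈ G.mats, m <:+ m' := ⟨m, hm, List.suffix_rfl⟩
    refine .head (simGrammar_capStep_mst (.choose hm) ⟨.inl rfl, Nat.sub_le _ _⟩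
      ⟨.inr hl, Nat.sub_le _ _⟩ (hf _) (hf _) (by rw [ntCount_idleWord]; omega)) ?_
    exact (simGrammar_reach_of_derivP hl h₁).trans
      (ih (fun m hm => hms m (List.mem_cons_of_mem _ hm)) h₂)

theorem FinLang_subset_simGrammar_capLang (G : MG N T) (k : ℕ) :
    G.FinLang k ⊆ (simGrammar G (k + 1)).CapLang (simCap (k + 1)) := by
  rintro w ⟨ms, hms, h⟩
  have hk : 1 ≤ k := by simpa [ntCount] using h.holds_left
  have hinit : Fits G (k + 1) (.p₀ [] k) (idleWord [Symb.nt G.start]) :=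
    fits_idleWord (by simp [Phase.places, ntCount])
  have hfin : Fits G (k + 1) (.p₀ [] (k + 1)) (idleWord (w.map Symb.tm)) :=
    fits_idleWord (by simp [Phase.places, ntCount_map_tm])
  have hmid := simGrammar_reach_of_flatten hms h
  simp only [ntCount, ntCount_map_tm, Nat.add_zero, Nat.add_sub_cancel, Nat.sub_zero] at hmid
  refine .head (b := simInit G k) ⟨⟨_, (finite_setOf_simRule G _).mem_toFinset.2 (.init rfl), [], [],
    rfl, by simp⟩, fun A => ?_, hinit.capOK ?_⟩ (hmid.tail
      ⟨simGrammar_step_iff.2 (.inr (.inl ⟨rfl, ?_⟩)), hfin.capOK ?_, fun A => ?_⟩)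
  · cases A <;> simp [simGrammar, symCount, simCap]
  · simp [ntCount_idleWord, ntCount]
  · rw [expand_idleWord_map_tm]
  · simp [ntCount_idleWord, ntCount_map_tm]
  · simp [symCount_map_tm]

end Simulation

theorem MATfin_subset_GScb (T : Type) : MATfin T ⊆ GScb T := by
  rintro _ ⟨N, _, G, k, rfl, h⟩
  rw [(h.trans (FinLang_subset_simGrammar_capLang G k)).antisymm (simGrammar_capLang_subset k)]
  exact GSG.capLang_mem_GScb _ _

/-- GS_cb = MAT_fin. -/
theorem GScb_eq_MATfin (T : Type) : GScb T = MATfin T :=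
  (GScb_subset_MATfin T).antisymm (MATfin_subset_GScb T)

end CapGram
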